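/- Let X be a minimal Banach space not containing an isomorphic copy of ℓ₁. Then the class NC_X = {Y ∈ SB : Y does not contain an isomorphic copy of X} is strongly bounded: for every analytic subset A of NC_X there exists V ∈ NC_X such that every Y ∈ A embeds isomorphically into V. -/

import Mathlib

open Filter Topology MeasureTheory

noncomputable section

/-! ### The Cantor set and the space `C(2^ℕ)` -/

/-- The Cantor set `2^ℕ`. -/
abbrev CantorSet : Type := ℕ → Bool

/-- The Banach space `C(2^ℕ)` of continuous real-valued functions on the Cantor set. -/
abbrev CantorC : Type := C(CantorSet, ℝ)

/-! ### The standard Borel space `SB` of separable Banach spaces -/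

/-- `SB`: the set of closed linear subspaces of `C(2^ℕ)`. -/
def SB : Type := {Y : Submodule ℝ CantorC // IsClosed (Y : Set CantorC)}

/-- The Effros-Borel σ-algebra on `SB`, generated by the sets
`{Y : Y ∩ U ≠ ∅}` for `U` open in `C(2^ℕ)`. -/
instance : MeasurableSpace SB :=
  MeasurableSpace.generateFrom
    {A : Set SB | ∃ U : Set CantorC, IsOpen U ∧ A = {Y : SB | ((Y.1 : Set CantorC) ∩ U).Nonempty}}

/-- A subset of a standard Borel space is analytic if it is the image of a Borel map
from the Baire space `ℕ^ℕ`. -/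
def IsAnalyticIn {α : Type*} [MeasurableSpace α] (A : Set α) : Prop :=
  ∃ f : (ℕ → ℕ) → α, Measurable f ∧ A = Set.range f

/-! ### Embeddings, isomorphisms, universality -/

/-- `X` embeds isomorphically into `Y`: there is a bounded linear map which is
bounded below, i.e. an isomorphism onto its range. -/
def Embeds (X Y : Type*) [SeminormedAddCommGroup X] [NormedSpace ℝ X]
    [SeminormedAddCommGroup Y] [NormedSpace ℝ Y] : Prop :=
  ∃ (T : X →L[ℝ] Y) (c : ℝ), 0 < c ∧ ∀ x : X, c * ‖x‖ ≤ ‖T x‖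

/-- `X` embeds isometrically into `Y` (i.e. `Y` contains an isometric copy of `X`). -/
def EmbedsIsometrically (X Y : Type*) [SeminormedAddCommGroup X] [NormedSpace ℝ X]
    [SeminormedAddCommGroup Y] [NormedSpace ℝ Y] : Prop :=
  Nonempty (X →ₗᵢ[ℝ] Y)

/-- `X` and `Y` are isomorphic Banach spaces (linearly homeomorphic). -/
def IsomorphicTo (X Y : Type*) [SeminormedAddCommGroup X] [NormedSpace ℝ X]
    [SeminormedAddCommGroup Y] [NormedSpace ℝ Y] : Prop :=
  Nonempty (X ≃L[ℝ] Y)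

/-- The class `NU ⊆ SB` of non-universal spaces: those `X ∈ SB` which do not contain
an isomorphic copy of `C(2^ℕ)` (equivalently, are not universal for all separable
Banach spaces). -/
def NU : Set SB := {Y : SB | ¬ Embeds CantorC Y.1}

/-- The class `NC_X ⊆ SB` of all `Y ∈ SB` containing no isomorphic copy of `X`. -/
def NCin (X : Type*) [SeminormedAddCommGroup X] [NormedSpace ℝ X] : Set SB :=
  {Y : SB | ¬ Embeds X Y.1}

/-! ### Schauder bases -/

/-- `x` is a Schauder basis of `E`: every vector has a unique representation as a
norm convergent series `Σ aₙ • xₙ`. -/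
def IsSchauderBasis {E : Type*} [SeminormedAddCommGroup E] [NormedSpace ℝ E]
    (x : ℕ → E) : Prop :=
  ∀ y : E, ∃! a : ℕ → ℝ,
    Tendsto (fun m => ∑ n ∈ Finset.range m, a n • x n) atTop (𝓝 y)

/-- `E` has a Schauder basis. -/
def HasSchauderBasis (E : Type*) [SeminormedAddCommGroup E] [NormedSpace ℝ E] : Prop :=
  ∃ x : ℕ → E, IsSchauderBasis x

/-- `x` is a monotone basis sequence: initial-segment projections have norm at most 1. -/
def IsMonotoneSeq {E : Type*} [SeminormedAddCommGroup E] [NormedSpace ℝ E]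
    (x : ℕ → E) : Prop :=
  ∀ (a : ℕ → ℝ) (k m : ℕ), k ≤ m →
    ‖∑ n ∈ Finset.range k, a n • x n‖ ≤ ‖∑ n ∈ Finset.range m, a n • x n‖

/-- `x` is a bi-monotone sequence: interval projections have norm at most 1. -/
def IsBimonotoneSeq {E : Type*} [SeminormedAddCommGroup E] [NormedSpace ℝ E]
    (x : ℕ → E) : Prop :=
  ∀ (a : ℕ → ℝ) (j k m : ℕ), j ≤ k → k ≤ m →
    ‖∑ n ∈ Finset.Ico j k, a n • x n‖ ≤ ‖∑ n ∈ Finset.range m, a n • x n‖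

/-- `x` is a Schauder basic sequence: it is a Schauder basis of its closed linear span. -/
def IsSchauderBasicSeq {E : Type*} [NormedAddCommGroup E] [NormedSpace ℝ E]
    (x : ℕ → E) : Prop :=
  ∀ y ∈ (Submodule.span ℝ (Set.range x)).topologicalClosure,
    ∃! a : ℕ → ℝ,
      Tendsto (fun m => ∑ n ∈ Finset.range m, a n • x n) atTop (𝓝 y)

/-! ### Trees, ordinal ranks and Bourgain's index -/

/-- A tree on `Λ`: a set of finite sequences closed under initial segments. -/
def IsTree {Λ : Type*} (T : Set (List Λ)) : Prop :=
  ∀ s t : List Λ, s <+: t → t ∈ T → s ∈ T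

/-- A pruned tree: every node has a proper extension in the tree. -/
def IsPruned {Λ : Type*} (T : Set (List Λ)) : Prop :=
  ∀ t ∈ T, ∃ a : Λ, t ++ [a] ∈ T

/-- `σ` is an infinite branch of `T`. -/
def IsBranch {Λ : Type*} (T : Set (List Λ)) (σ : ℕ → Λ) : Prop :=
  ∀ n : ℕ, (List.ofFn fun i : Fin n => σ i) ∈ T

/-- `T` is ill-founded: it has an infinite branch. -/
def TreeIllFounded {Λ : Type*} (T : Set (List Λ)) : Prop :=
  ∃ σ : ℕ → Λ, IsBranch T σ

/-- The derivative of a tree: its non-maximal nodes, i.e. nodes having a proper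
extension in the tree. -/
def treeDeriv {Λ : Type*} (T : Set (List Λ)) : Set (List Λ) :=
  {l | l ∈ T ∧ ∃ a : Λ, l ++ [a] ∈ T}

/-- The iterated derivatives `T^(ξ)` of a tree, defined by transfinite recursion. -/
def treeDerivIter {Λ : Type*} (T : Set (List Λ)) (ξ : Ordinal.{0}) : Set (List Λ) :=
  Ordinal.limitRecOn ξ T (fun _ S => treeDeriv S)
    (fun o _ ih => ⋂ (o' : Ordinal.{0}) (h : o' < o), ih o' h)

/-- The ordinal rank `o(T)` of a (well-founded) tree: the least `ξ` with `T^(ξ) = ∅`. -/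
def treeRank {Λ : Type*} (T : Set (List Λ)) : Ordinal.{0} :=
  sInf {ξ : Ordinal.{0} | treeDerivIter T ξ = ∅}

/-- The first uncountable ordinal `ω₁`. -/
def omega1 : Ordinal.{0} := (Cardinal.aleph 1).ord

/-- Bourgain's tree `T(Y, (e_n), δ)`: all finite sequences `(y_0, …, y_k)` in `Y`
which are `δ`-equivalent to `(e_0, …, e_k)`. -/
def bourgainTree {W : Type*} [SeminormedAddCommGroup W] [NormedSpace ℝ W] (e : ℕ → W)
    (δ : ℝ) (Y : Type*) [SeminormedAddCommGroup Y] [NormedSpace ℝ Y] : Set (List Y) :=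
  {l : List Y | ∀ a : ℕ → ℝ,
    δ * ‖∑ i ∈ Finset.range l.length, a i • e i‖ ≤
        ‖∑ i ∈ Finset.range l.length, a i • l.getD i 0‖ ∧
    ‖∑ i ∈ Finset.range l.length, a i • l.getD i 0‖ ≤
        δ⁻¹ * ‖∑ i ∈ Finset.range l.length, a i • e i‖}

open Classical in
/-- Bourgain's ordinal index of `Y` relative to a (normalized Schauder) basis `(e_n)`
of a space `W`: it equals `ω₁` if some tree `T(Y, (e_n), δ)` is ill-founded, and
otherwise `sup_{0 < δ ≤ 1} o(T(Y, (e_n), δ))`.  With `W = C(2^ℕ)` this is `φ_NU`,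
and with `W = Z` it is `φ_{NC_Z}`. -/
def bourgainIndex {W : Type*} [SeminormedAddCommGroup W] [NormedSpace ℝ W] (e : ℕ → W)
    (Y : Type*) [SeminormedAddCommGroup Y] [NormedSpace ℝ Y] : Ordinal.{0} :=
  if ∃ δ ∈ Set.Ioc (0:ℝ) 1, TreeIllFounded (bourgainTree e δ Y) then omega1
  else ⨆ δ : Set.Ioc (0:ℝ) 1, treeRank (bourgainTree e δ.1 Y)

/-! ### The Schur property and the Radon-Nikodym property -/

/-- `X` has the Schur property: weakly convergent sequences are norm convergent. -/
def HasSchurProperty (X : Type*) [SeminormedAddCommGroup X] [NormedSpace ℝ X] : Prop :=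
  ∀ (f : ℕ → X) (x : X),
    (∀ φ : X →L[ℝ] ℝ, Tendsto (fun n => φ (f n)) atTop (𝓝 (φ x))) →
    Tendsto f atTop (𝓝 x)

/-- `X` has the Radon-Nikodym property: on every finite measure space, every
`X`-valued vector measure of bounded variation which is absolutely continuous
with respect to the measure has a Bochner-integrable density. -/
def HasRNP (X : Type*) [NormedAddCommGroup X] [NormedSpace ℝ X] : Prop :=
  ∀ (Ω : Type) [MeasurableSpace Ω] (μ : Measure Ω), IsFiniteMeasure μ →
    ∀ τ : VectorMeasure Ω X,
      (∀ s : Set Ω, MeasurableSet s → μ s = 0 → τ s = 0) →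
      (∃ C : ℝ, ∀ P : Finset (Set Ω), (∀ s ∈ P, MeasurableSet s) →
        ((P : Set (Set Ω)).Pairwise fun s t => Disjoint s t) →
        ∑ s ∈ P, ‖τ s‖ ≤ C) →
      ∃ g : Ω → X, Integrable g μ ∧
        ∀ s : Set Ω, MeasurableSet s → τ s = ∫ x in s, g x ∂μ

/-! ### `𝓛_{∞,λ}`-spaces -/

/-- The Banach-Mazur distance from `G` to `ℓ∞^n` is at most `θ`, witnessed by an
isomorphism `e` with `‖e‖ ⬝ ‖e⁻¹‖ ≤ θ'` for every `θ' > θ`. -/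
def BMdistToLinftyLE (G : Type*) [SeminormedAddCommGroup G] [NormedSpace ℝ G]
    (n : ℕ) (θ : ℝ) : Prop :=
  ∀ θ' : ℝ, θ < θ' → ∃ e : G ≃L[ℝ] (Fin n → ℝ),
    ‖(e : G →L[ℝ] (Fin n → ℝ))‖ * ‖(e.symm : (Fin n → ℝ) →L[ℝ] G)‖ ≤ θ'

/-- `X` is an (infinite-dimensional) `𝓛_{∞,λ}`-space: every finite-dimensional subspace
`F` of `X` is contained in a finite-dimensional subspace `G` with `d(G, ℓ∞^(dim G)) ≤ λ`. -/
def IsLinftyLam (lam : ℝ) (X : Type*) [NormedAddCommGroup X] [NormedSpace ℝ X] : Prop :=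
  (¬ FiniteDimensional ℝ X) ∧
  ∀ F : Submodule ℝ X, FiniteDimensional ℝ F →
    ∃ G : Submodule ℝ X, F ≤ G ∧ FiniteDimensional ℝ G ∧
      BMdistToLinftyLE G (Module.finrank ℝ G) lam

/-- `X` is an `𝓛_{∞,λ+}`-space: it is an `𝓛_{∞,θ}`-space for every `θ > λ`. -/
def IsLinftyPlus (lam : ℝ) (X : Type*) [NormedAddCommGroup X] [NormedSpace ℝ X] : Prop :=
  ∀ θ : ℝ, lam < θ → IsLinftyLam θ X

/-! ### Minimal spaces and `ℓ₁` -/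

/-- The space `ℓ₁`. -/
abbrev EllOne : Type := lp (fun _ : ℕ => ℝ) 1

/-- `X` is a minimal Banach space: it is infinite-dimensional and embeds isomorphically
into every infinite-dimensional (closed) subspace of itself. -/
def IsMinimal (X : Type*) [NormedAddCommGroup X] [NormedSpace ℝ X] : Prop :=
  (¬ FiniteDimensional ℝ X) ∧
  ∀ Z : Submodule ℝ X, IsClosed (Z : Set X) → ¬ FiniteDimensional ℝ Z → Embeds X Z

end


open Filter Topology

namespace NCX

section general
variable {X : Type*} [NormedAddCommGroup X] [NormedSpace ℝ X]

/-- infinite-dimensional submodule -/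
def InfD (S : Submodule ℝ X) : Prop := ¬ S.FG

lemma InfD.inf_ker {S : Submodule ℝ X} (hS : InfD S) {G : Type*} [AddCommGroup G] [Module ℝ G]
    (L : X →ₗ[ℝ] G) (hL : (LinearMap.range L).FG) : InfD (S ⊓ LinearMap.ker L) := by
  intro h
  apply hS
  refine Submodule.fg_of_fg_map_of_fg_inf_ker L ?_ h
  have : FiniteDimensional ℝ (LinearMap.range L) :=
    (Submodule.fg_iff_finiteDimensional _).1 hL
  rw [Submodule.fg_iff_finiteDimensional]
  exact Submodule.finiteDimensional_of_le (LinearMap.map_le_range (f := L))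

lemma InfD.inf_kers {ι : Type*} (s : Finset ι) {S : Submodule ℝ X} (hS : InfD S) {G : Type*}
    [AddCommGroup G] [Module ℝ G]
    (L : ι → X →ₗ[ℝ] G) (hL : ∀ i ∈ s, (LinearMap.range (L i)).FG) :
    ∃ S' ≤ S, InfD S' ∧ ∀ x ∈ S', ∀ i ∈ s, L i x = 0 := by
  classical
  induction s using Finset.induction_on with
  | empty => exact ⟨S, le_rfl, hS, by simp⟩
  | insert i s hi ih =>
    obtain ⟨S', h1, h2, h3⟩ := ih (fun j hj => hL j (Finset.mem_insert_of_mem hj))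
    refine ⟨S' ⊓ LinearMap.ker (L i), inf_le_left.trans h1,
      h2.inf_ker _ (hL i (Finset.mem_insert_self _ _)), ?_⟩
    rintro x ⟨hx1, hx2⟩ j hj
    rcases Finset.mem_insert.1 hj with rfl | hj
    · exact hx2
    · exact h3 x hx1 j hj

lemma InfD.exists_unit {S : Submodule ℝ X} (hS : InfD S) : ∃ x ∈ S, ‖x‖ = 1 := by
  by_contra! h
  apply hS
  have : S = ⊥ := by
    rw [Submodule.eq_bot_iff]
    intro x hx
    by_contra hx0
    have := h (‖x‖⁻¹ • x) (S.smul_mem _ hx)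
    rw [norm_smul, norm_inv, norm_norm] at this
    exact this (inv_mul_cancel₀ (norm_ne_zero_iff.2 hx0))
  rw [this]; exact Submodule.fg_bot

lemma range_fg_real (φ : X →ₗ[ℝ] ℝ) : (LinearMap.range φ).FG :=
  IsNoetherian.noetherian _

lemma coef_rec (a : ℕ → ℝ) (Y : ℝ)
    (h : ∀ k, |a k| ≤ Y + ∑ j ∈ Finset.range k, |a j|) : ∀ k, |a k| ≤ 2 ^ k * Y := by
  have key : ∀ k, Y + ∑ j ∈ Finset.range k, |a j| ≤ 2 ^ k * Y := by
    intro k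
    induction k with
    | zero => simp
    | succ k ih =>
      rw [Finset.sum_range_succ]
      have := h k
      rw [pow_succ]; linarith
  exact fun k => (h k).trans (key k)

lemma seqQ {S : Submodule ℝ X} (hS : InfD S) (Q : ℕ → X → Prop)
    (hQm : ∀ k l x, k ≤ l → Q l x → Q k x)
    (hQ : ∀ k, ∀ S' ≤ S, InfD S' → ∃ x ∈ S', ‖x‖ = 1 ∧ Q k x) :
    ∃ x : ℕ → X, (∀ k, x k ∈ S ∧ ‖x k‖ = 1 ∧ Q k (x k)) ∧
      ∀ (a : ℕ →₀ ℝ) k, |a k| ≤ 2 ^ k * ‖Finsupp.linearCombination ℝ x a‖ := by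
  classical
  obtain ⟨f, hf1, hf2⟩ := exists_seq_of_forall_finset_exists
    (α := ℕ × X × (X →L[ℝ] ℝ))
    (fun p => p.2.1 ∈ S ∧ ‖p.2.1‖ = 1 ∧ Q p.1 p.2.1 ∧ ‖p.2.2‖ ≤ 1 ∧ p.2.2 p.2.1 = 1)
    (fun p q => p.1 < q.1 ∧ p.2.2 q.2.1 = 0) (by
      intro s hs
      obtain ⟨S', h1, h2, h3⟩ := InfD.inf_kers s hS (fun p => (p.2.2 : X →ₗ[ℝ] ℝ))
        (fun p _ => range_fg_real _)
      obtain ⟨x, hx, hx1, hxQ⟩ := hQ (s.sup (fun p => p.1) + 1) S' h1 h2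
      obtain ⟨φ, hφ, hφx⟩ := exists_dual_vector ℝ x (by intro h; simp [h] at hx1)
      refine ⟨(s.sup (fun p => p.1) + 1, x, φ), ⟨h1 hx, hx1, hxQ, hφ.le, ?_⟩, ?_⟩
      · simp [hφx, hx1]
      · intro p hp
        exact ⟨Nat.lt_succ_of_le (Finset.le_sup (f := fun p : ℕ × X × (X →L[ℝ] ℝ) => p.1) hp),
          h3 x hx p hp⟩)
  have hmono : StrictMono (fun n => (f n).1) := fun m n h => (hf2 m n h).1
  refine ⟨fun n => (f n).2.1, fun k => ⟨(hf1 k).1, (hf1 k).2.1,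
    hQm k _ _ (hmono.id_le k) (hf1 k).2.2.1⟩, fun a => coef_rec _ _ fun k => ?_⟩
  set y := Finsupp.linearCombination ℝ (fun n => (f n).2.1) a with hy
  set φ := (f k).2.2
  have h1 : φ y = ∑ j ∈ a.support ∪ Finset.range (k+1), a j * φ ((f j).2.1) := by
    rw [hy, Finsupp.linearCombination_apply, Finsupp.sum_of_support_subset _
      (Finset.subset_union_left (s₂ := Finset.range (k+1))) _ (by simp)]
    simp
  have h2 : φ y = ∑ j ∈ Finset.range (k+1), a j * φ ((f j).2.1) := by
    rw [h1]
    symm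
    apply Finset.sum_subset Finset.subset_union_right
    intro j _ hj
    have hkj : k < j := by simpa [Nat.lt_succ_iff] using hj
    rw [(hf2 k j hkj).2, mul_zero]
  rw [Finset.sum_range_succ, (hf1 k).2.2.2.2, mul_one] at h2
  have h3 : a k = φ y - ∑ j ∈ Finset.range k, a j * φ ((f j).2.1) := by linarith
  have hn : ∀ z, |φ z| ≤ ‖z‖ := fun z => by
    have := φ.le_of_opNorm_le (hf1 k).2.2.2.1 z
    simpa using this
  rw [h3]
  refine (abs_sub _ _).trans (add_le_add (hn y) ((Finset.abs_sum_le_sum_abs _ _).trans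
    (Finset.sum_le_sum fun j _ => ?_)))
  rw [abs_mul]
  have := hn (f j).2.1
  rw [(hf1 j).2.1] at this
  exact mul_le_of_le_one_right (abs_nonneg _) this

lemma sum_small {G : Type*} [AddCommGroup G] [Module ℝ G] (q : Seminorm ℝ G) (v : ℕ → G)
    (ε Y : ℝ) (hε : 0 ≤ ε) (hY : 0 ≤ Y)
    (hv : ∀ k, q (v k) ≤ ε * (1/4) ^ k / 2) (a : ℕ →₀ ℝ) (ha : ∀ k, |a k| ≤ 2 ^ k * Y) :
    q (Finsupp.linearCombination ℝ v a) ≤ ε * Y := by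
  rw [Finsupp.linearCombination_apply, Finsupp.sum]
  have h1 : q (∑ k ∈ a.support, a k • v k) ≤ ∑ k ∈ a.support, q (a k • v k) :=
    Finset.le_sum_of_subadditive q (map_zero q).le (map_add_le_add q) _ _
  refine h1.trans ?_
  have h2 : ∑ k ∈ a.support, q (a k • v k) ≤ ∑ k ∈ a.support, ε * Y * ((1/2) ^ k / 2) := by
    apply Finset.sum_le_sum
    intro k _
    rw [map_smul_eq_mul, Real.norm_eq_abs]
    calc |a k| * q (v k) ≤ (2 ^ k * Y) * (ε * (1/4) ^ k / 2) :=
          mul_le_mul (ha k) (hv k) (apply_nonneg _ _) (by positivity)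
      _ = ε * Y * ((1/2) ^ k / 2) := by
          have : (2:ℝ) ^ k * (1/4) ^ k = (1/2) ^ k := by rw [← mul_pow]; norm_num
          linear_combination (ε * Y / 2) * this
  refine h2.trans ?_
  rw [← Finset.mul_sum]
  apply mul_le_of_le_one_right (by positivity)
  have h3 : HasSum (fun k : ℕ => ((1:ℝ)/2) ^ k / 2) 1 := by
    have := hasSum_geometric_two.div_const 2
    simpa using this
  exact sum_le_hasSum _ (fun k _ => by positivity) h3

lemma linIndep_of_coef {x : ℕ → X}
    (hx : ∀ (a : ℕ →₀ ℝ) k, |a k| ≤ 2 ^ k * ‖Finsupp.linearCombination ℝ x a‖) :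
    LinearIndependent ℝ x := by
  rw [linearIndependent_iff]
  intro a ha
  ext k
  have := hx a k
  rw [ha] at this
  simpa using this

lemma infD_span {x : ℕ → X} (hx : LinearIndependent ℝ x) :
    InfD (Submodule.span ℝ (Set.range x)) := by
  intro h
  have : FiniteDimensional ℝ (Submodule.span ℝ (Set.range x)) :=
    (Submodule.fg_iff_finiteDimensional _).1 h
  have h2 := (linearIndependent_span hx)
  exact Infinite.not_finite (h2.finite)

lemma lemS {G : Type*} [NormedAddCommGroup G] [NormedSpace ℝ G] {ι : Type*}
    (f : ι → X →L[ℝ] G) {S : Submodule ℝ X} (hS : InfD S)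
    (h : ∀ S' ≤ S, InfD S' → ∀ δ > 0, ∃ x ∈ S', ‖x‖ = 1 ∧ ∀ n, ‖f n x‖ ≤ δ) (ε : ℝ) (hε : 0 < ε) :
    ∃ S' ≤ S, InfD S' ∧ ∀ x ∈ S', ∀ n, ‖f n x‖ ≤ ε * ‖x‖ := by
  obtain ⟨x, hx1, hx2⟩ := seqQ hS (fun k x => ∀ n, ‖f n x‖ ≤ ε * (1/4) ^ k / 2)
    (by
      intro k l x hkl hx n
      refine (hx n).trans ?_
      have : ((1:ℝ)/4) ^ l ≤ (1/4) ^ k := pow_le_pow_of_le_one (by norm_num) (by norm_num) hkl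
      gcongr)
    (fun k S' hS' hI => h S' hS' hI _ (by positivity))
  refine ⟨Submodule.span ℝ (Set.range x), ?_, infD_span (linIndep_of_coef hx2), ?_⟩
  · rw [Submodule.span_le]; rintro _ ⟨k, rfl⟩; exact (hx1 k).1
  · intro y hy n
    obtain ⟨a, rfl⟩ := (Finsupp.mem_span_range_iff_exists_finsupp).1 hy
    have e1 : (a.sum fun i b => b • x i) = Finsupp.linearCombination ℝ x a := rfl
    rw [e1]
    have := sum_small (normSeminorm ℝ G) (fun k => f n (x k)) ε _ hε.le (norm_nonneg _)
      (fun k => (hx1 k).2.2 n) a (hx2 a)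
    have e2 : f n (Finsupp.linearCombination ℝ x a) =
        Finsupp.linearCombination ℝ (fun k => f n (x k)) a := by
      have := Finsupp.apply_linearCombination ℝ (f n : X →ₗ[ℝ] G) x a
      exact this
    rw [e2]; exact this

end general

end NCX

open Filter Topology

namespace NCX

section humps
variable {X : Type*} [NormedAddCommGroup X] [NormedSpace ℝ X]
variable {G : Type*} [NormedAddCommGroup G] [NormedSpace ℝ G]

lemma ellOne_summable (a : EllOne) : Summable (fun k => |a k|) := by
  have := lp.memℓp a
  rw [memℓp_gen_iff (by simp)] at this
  simpa using this

lemma ellOne_norm (a : EllOne) : ‖a‖ = ∑' k, |a k| := by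
  rw [lp.norm_eq_tsum_rpow (by simp)]
  simp

lemma embeds_ellOne [CompleteSpace X] (x : ℕ → X) (hx : ∀ k, ‖x k‖ = 1) (c : ℝ) (hc : 0 < c)
    (h : ∀ (a : ℕ → ℝ) n, c * ∑ k ∈ Finset.range n, |a k| ≤ ‖∑ k ∈ Finset.range n, a k • x k‖) :
    Embeds EllOne X := by
  have hn : ∀ (a : EllOne) k, ‖a k • x k‖ = |a k| := fun a k => by
    rw [norm_smul, hx, mul_one, Real.norm_eq_abs]
  have hs : ∀ a : EllOne, Summable (fun k => a k • x k) := by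
    intro a
    apply Summable.of_norm
    simpa only [hn] using ellOne_summable a
  let T : EllOne →ₗ[ℝ] X :=
    { toFun := fun a => ∑' k, a k • x k
      map_add' := by
        intro a b
        rw [← (hs a).tsum_add (hs b)]
        exact tsum_congr fun k => by simp [add_smul]
      map_smul' := by
        intro r a
        simp only [RingHom.id_apply]
        rw [← (hs a).tsum_const_smul]
        exact tsum_congr fun k => by simp [smul_smul] }
  refine ⟨T.mkContinuous 1 ?_, c, hc, ?_⟩
  · intro a
    rw [one_mul, ellOne_norm]
    refine (norm_tsum_le_tsum_norm ?_).trans (le_of_eq (tsum_congr (hn a)))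
    simpa only [hn] using ellOne_summable a
  · intro a
    rw [LinearMap.mkContinuous_apply, ellOne_norm]
    have h1 : Tendsto (fun n => c * ∑ k ∈ Finset.range n, |a k|) atTop (𝓝 (c * ∑' k, |a k|)) :=
      ((ellOne_summable a).hasSum.tendsto_sum_nat).const_mul c
    have h2 : Tendsto (fun n => ‖∑ k ∈ Finset.range n, a k • x k‖) atTop (𝓝 ‖T a‖) :=
      ((hs a).hasSum.tendsto_sum_nat).norm
    exact le_of_tendsto_of_tendsto' h1 h2 (fun n => h _ n)

lemma A0 [CompleteSpace X] (T : ℕ → X →L[ℝ] G) (K : ℝ)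
    (hK : ∀ m x, ∑ n ∈ Finset.range m, ‖T n x‖ ≤ K * ‖x‖) (η : ℝ) (hη : 0 < η)
    (h : ∀ N, ∀ δ > 0, ∃ x, ‖x‖ = 1 ∧ ∑ n ∈ Finset.range N, ‖T n x‖ ≤ δ ∧
      ∃ m, η < ∑ n ∈ Finset.range m, ‖T n x‖) : Embeds EllOne X := by
  classical
  have hsum : ∀ x, Summable (fun n => ‖T n x‖) := fun x =>
    summable_of_sum_range_le (fun n => norm_nonneg _) (fun m => hK m x)
  have htail : ∀ x, ∀ δ > 0, ∃ N, ∀ N' ≥ N, ∀ m, ∑ n ∈ Finset.Ico N' m, ‖T n x‖ ≤ δ := by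
    intro x δ hδ
    have := (hsum x).hasSum.tendsto_sum_nat
    obtain ⟨N, hN⟩ := (Metric.tendsto_atTop.1 this) δ hδ
    refine ⟨N, fun N' hN' m => ?_⟩
    rcases le_total m N' with hm | hm
    · simp [Finset.Ico_eq_empty_of_le hm, hδ.le]
    have e := Finset.sum_range_add_sum_Ico (fun n => ‖T n x‖) hm
    have h1 := hN N' hN'
    have h2 : ∑ n ∈ Finset.range m, ‖T n x‖ ≤ ∑' n, ‖T n x‖ :=
      (hsum x).sum_le_tsum _ (fun n _ => norm_nonneg _)
    rw [Real.dist_eq, abs_lt] at h1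
    linarith [h1.1]
  obtain ⟨f, hf1, hf2⟩ := exists_seq_of_forall_finset_exists
    (α := ℕ × X × ℕ)
    (fun p => ‖p.2.1‖ = 1 ∧ ∑ n ∈ Finset.range p.2.2, ‖T n p.2.1‖ ≤ η / 8 ∧
      ∃ m, η < ∑ n ∈ Finset.range m, ‖T n p.2.1‖)
    (fun p q => p.1 < q.1 ∧ p.2.2 ≤ q.2.2 ∧ η < ∑ n ∈ Finset.range q.2.2, ‖T n p.2.1‖ ∧
      ∀ m, ∑ n ∈ Finset.Ico q.2.2 m, ‖T n p.2.1‖ ≤ η * (1/2) ^ q.1 / 8) (by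
      intro s hs
      set i := s.sup (fun p => p.1) + 1
      have hN : ∃ N, ∀ p ∈ s, p.2.2 ≤ N ∧ η < ∑ n ∈ Finset.range N, ‖T n p.2.1‖ ∧
          ∀ m, ∑ n ∈ Finset.Ico N m, ‖T n p.2.1‖ ≤ η * (1/2) ^ i / 8 := by
        have : ∀ p : ℕ × X × ℕ, ∃ N, p ∈ s → ∀ N' ≥ N, p.2.2 ≤ N' ∧
            η < ∑ n ∈ Finset.range N', ‖T n p.2.1‖ ∧
            ∀ m, ∑ n ∈ Finset.Ico N' m, ‖T n p.2.1‖ ≤ η * (1/2) ^ i / 8 := by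
          intro p
          by_cases hp : p ∈ s
          · obtain ⟨m, hm⟩ := (hs p hp).2.2
            obtain ⟨N, hN⟩ := htail p.2.1 (η * (1/2) ^ i / 8) (by positivity)
            refine ⟨max p.2.2 (max m N), fun _ N' hN' => ⟨le_trans (le_max_left _ _) hN', ?_, ?_⟩⟩
            · refine hm.trans_le (Finset.sum_le_sum_of_subset_of_nonneg ?_
                (fun _ _ _ => norm_nonneg _))
              exact Finset.range_mono
                (le_trans (le_trans (le_max_left _ _) (le_max_right _ _)) hN')
            · exact hN N' (le_trans (le_trans (le_max_right _ _) (le_max_right _ _)) hN')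
          · exact ⟨0, fun h => absurd h hp⟩
        choose g hg using this
        exact ⟨s.sup g, fun p hp => hg p hp _ (Finset.le_sup hp)⟩
      obtain ⟨N, hN⟩ := hN
      obtain ⟨x, hx1, hx2, hx3⟩ := h N (η / 8) (by positivity)
      refine ⟨(i, x, N), ⟨hx1, hx2, hx3⟩, fun p hp => ⟨?_, (hN p hp).1, (hN p hp).2⟩⟩
      exact Nat.lt_succ_of_le (Finset.le_sup (f := fun p : ℕ × X × ℕ => p.1) hp))
  have hmono : StrictMono (fun n => (f n).1) := fun m n h => (hf2 m n h).1
  set x : ℕ → X := fun k => (f k).2.1 with hxdef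
  set N : ℕ → ℕ := fun k => (f k).2.2 with hNdef
  have hNm : ∀ k, N k ≤ N (k+1) := fun k => (hf2 k (k+1) (Nat.lt_succ_self k)).2.1
  have hx1 : ∀ k, ‖x k‖ = 1 := fun k => (hf1 k).1
  have hlow : ∀ k, ∑ n ∈ Finset.range (N k), ‖T n (x k)‖ ≤ η / 8 := fun k => (hf1 k).2.1
  have hhigh : ∀ k, η < ∑ n ∈ Finset.range (N (k+1)), ‖T n (x k)‖ :=
    fun k => (hf2 k (k+1) (Nat.lt_succ_self k)).2.2.1
  have ht : ∀ k l, k < l → ∀ m, ∑ n ∈ Finset.Ico (N l) m, ‖T n (x k)‖ ≤ η * (1/2) ^ l / 8 := by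
    intro k l hkl m
    refine ((hf2 k l hkl).2.2.2 m).trans ?_
    have : ((1:ℝ)/2) ^ (f l).1 ≤ (1/2) ^ l :=
      pow_le_pow_of_le_one (by norm_num) (by norm_num) (hmono.id_le l)
    gcongr
  have claim : ∀ (a : ℕ → ℝ) k, (η / 2 + η * (1/2) ^ k / 4) * ∑ j ∈ Finset.range k, |a j| ≤
      ∑ n ∈ Finset.range (N k), ‖T n (∑ j ∈ Finset.range k, a j • x j)‖ := by
    intro a k
    induction k with
    | zero => simp
    | succ k ih =>
      rw [Finset.sum_range_succ (fun j => a j • x j), Finset.sum_range_succ (fun j => |a j|)]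
      set y := ∑ j ∈ Finset.range k, a j • x j with hy
      have e := fun z => Finset.sum_range_add_sum_Ico (fun n => ‖T n z‖) (hNm k)
      rw [← e]
      have hT : ∀ n, T n (y + a k • x k) = T n y + a k • T n (x k) := by
        intro n; rw [map_add, map_smul]
      have b1 : ∑ n ∈ Finset.range (N k), ‖T n y‖ -
          |a k| * ∑ n ∈ Finset.range (N k), ‖T n (x k)‖ ≤
          ∑ n ∈ Finset.range (N k), ‖T n (y + a k • x k)‖ := by
        rw [Finset.mul_sum, ← Finset.sum_sub_distrib]
        apply Finset.sum_le_sum; intro n _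
        rw [hT]
        have := norm_sub_le_norm_add (T n y) (a k • T n (x k))
        rwa [norm_smul, Real.norm_eq_abs] at this
      have b2 : |a k| * ∑ n ∈ Finset.Ico (N k) (N (k+1)), ‖T n (x k)‖ -
          ∑ n ∈ Finset.Ico (N k) (N (k+1)), ‖T n y‖ ≤
          ∑ n ∈ Finset.Ico (N k) (N (k+1)), ‖T n (y + a k • x k)‖ := by
        rw [Finset.mul_sum, ← Finset.sum_sub_distrib]
        apply Finset.sum_le_sum; intro n _
        rw [hT, add_comm]
        have := norm_sub_le_norm_add (a k • T n (x k)) (T n y)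
        rwa [norm_smul, Real.norm_eq_abs] at this
      have b3 : ∑ n ∈ Finset.Ico (N k) (N (k+1)), ‖T n y‖ ≤
          (∑ j ∈ Finset.range k, |a j|) * (η * (1/2) ^ k / 8) := by
        calc ∑ n ∈ Finset.Ico (N k) (N (k+1)), ‖T n y‖
            ≤ ∑ n ∈ Finset.Ico (N k) (N (k+1)), ∑ j ∈ Finset.range k, |a j| * ‖T n (x j)‖ := by
              apply Finset.sum_le_sum; intro n _
              rw [hy, map_sum]
              refine (norm_sum_le _ _).trans (le_of_eq (Finset.sum_congr rfl fun j _ => ?_))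
              rw [map_smul, norm_smul, Real.norm_eq_abs]
          _ = ∑ j ∈ Finset.range k, |a j| * ∑ n ∈ Finset.Ico (N k) (N (k+1)), ‖T n (x j)‖ := by
              rw [Finset.sum_comm]; simp_rw [Finset.mul_sum]
          _ ≤ _ := by
              rw [Finset.sum_mul]
              apply Finset.sum_le_sum; intro j hj
              exact mul_le_mul_of_nonneg_left (ht j k (Finset.mem_range.1 hj) _) (abs_nonneg _)
      have b4 := hhigh k
      rw [← e] at b4
      have b5 := hlow k
      have b6 : 0 ≤ |a k| := abs_nonneg _
      have b7 : |a k| * (3 * η / 4) ≤ |a k| * ∑ n ∈ Finset.Ico (N k) (N (k+1)), ‖T n (x k)‖ -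
          |a k| * ∑ n ∈ Finset.range (N k), ‖T n (x k)‖ := by
        rw [← mul_sub]; apply mul_le_mul_of_nonneg_left _ b6; linarith
      have b8 : |a k| * (η / 2 + η * (1/2) ^ (k+1) / 4) ≤ |a k| * (3 * η / 4) := by
        apply mul_le_mul_of_nonneg_left _ b6
        have : ((1:ℝ)/2) ^ (k+1) ≤ 1 := pow_le_one₀ (by norm_num) (by norm_num)
        nlinarith
      rw [pow_succ] at b8 ⊢
      linarith
  have hKpos : 0 < K := by
    have h1 := hK (N 1) (x 0)
    rw [hx1, mul_one] at h1
    linarith [hhigh 0]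
  refine embeds_ellOne x hx1 (η / 2 / K) (by positivity) ?_
  intro a n
  have h1 := claim a n
  have h2 := hK (N n) (∑ j ∈ Finset.range n, a j • x j)
  have h3 : 0 ≤ ∑ j ∈ Finset.range n, |a j| := Finset.sum_nonneg fun _ _ => abs_nonneg _
  have h4 : 0 ≤ (η * (1/2) ^ n / 4) * ∑ j ∈ Finset.range n, |a j| := by positivity
  rw [div_mul_eq_mul_div, div_le_iff₀ hKpos]
  linarith

lemma A1 [CompleteSpace X] (hX : ¬ Embeds EllOne X) (T : ℕ → X →L[ℝ] G) (K : ℝ)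
    (hK : ∀ m x, ∑ n ∈ Finset.range m, ‖T n x‖ ≤ K * ‖x‖)
    (hT : ∀ n, (LinearMap.range (T n : X →ₗ[ℝ] G)).FG) {S : Submodule ℝ X} (hS : InfD S)
    (η : ℝ) (hη : 0 < η) : ∃ x ∈ S, ‖x‖ = 1 ∧ ∀ m, ∑ n ∈ Finset.range m, ‖T n x‖ ≤ η := by
  by_contra! hcon
  apply hX
  refine A0 T K hK η hη ?_
  intro N δ hδ
  obtain ⟨S', h1, h2, h3⟩ := InfD.inf_kers (Finset.range N) hS (fun n => (T n : X →ₗ[ℝ] G))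
    (fun n _ => hT n)
  obtain ⟨x, hx, hx1⟩ := h2.exists_unit
  refine ⟨x, hx1, ?_, hcon x (h1 hx) hx1⟩
  rw [Finset.sum_eq_zero]
  · exact hδ.le
  · intro n hn
    have := h3 x hx n hn
    simp only [ContinuousLinearMap.coe_coe] at this
    simp [this]

lemma A2 [CompleteSpace X] (hX : ¬ Embeds EllOne X) (T : ℕ → X →L[ℝ] G) (K : ℝ)
    (hK : ∀ m x, ∑ n ∈ Finset.range m, ‖T n x‖ ≤ K * ‖x‖) (c : ℝ) (hc : 0 < c)
    (h : ∀ x, ∃ m, c * ‖x‖ ≤ ∑ n ∈ Finset.range m, ‖T n x‖) :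
    ∃ N, ∃ c' > 0, ∀ x, c' * ‖x‖ ≤ ∑ n ∈ Finset.range N, ‖T n x‖ := by
  by_contra! hcon
  apply hX
  refine A0 T K hK (c / 2) (by positivity) ?_
  intro N δ hδ
  obtain ⟨x, hx⟩ := hcon N δ hδ
  have hx0 : 0 < ‖x‖ := by
    rcases (norm_nonneg x).eq_or_lt with h0 | h0
    · rw [← h0, mul_zero] at hx
      exact absurd hx (not_lt.2 (Finset.sum_nonneg fun _ _ => norm_nonneg _))
    · exact h0
  have hn1 : ‖‖x‖⁻¹ • x‖ = 1 := by
    rw [norm_smul, norm_inv, norm_norm, inv_mul_cancel₀ hx0.ne']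
  refine ⟨‖x‖⁻¹ • x, hn1, ?_, ?_⟩
  · simp_rw [map_smul, norm_smul, norm_inv, norm_norm]
    rw [← Finset.mul_sum, inv_mul_le_iff₀ hx0]
    linarith
  · obtain ⟨m, hm⟩ := h (‖x‖⁻¹ • x)
    exact ⟨m, by rw [hn1] at hm; linarith⟩

end humps
end NCX

open Filter Topology

namespace NCX

section ext
variable {W V G : Type*} [AddCommGroup W] [Module ℝ W] [NormedAddCommGroup V] [NormedSpace ℝ V]
  [NormedAddCommGroup G] [NormedSpace ℝ G]

lemma ext_exists [CompleteSpace G] (e : W →ₗ[ℝ] V) (he : DenseRange e) (f : W →ₗ[ℝ] G) (K : ℝ)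
    (h : ∀ w, ‖f w‖ ≤ K * ‖e w‖) :
    ∃ g : V →L[ℝ] G, (∀ w, g (e w) = f w) ∧ (∀ v, ‖g v‖ ≤ K * ‖v‖) ∧
      ((LinearMap.range f).FG → (LinearMap.range (g : V →ₗ[ℝ] G)).FG) := by
  have h1 : ∀ w, LinearMap.extendOfNorm f e (e w) = f w :=
    fun w => LinearMap.extendOfNorm_eq he ⟨K, h⟩ w
  refine ⟨LinearMap.extendOfNorm f e, h1,
    fun v => LinearMap.norm_extendOfNorm_apply_le he K h v, ?_⟩
  intro hf
  have : FiniteDimensional ℝ (LinearMap.range f) := (Submodule.fg_iff_finiteDimensional _).1 hf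
  have hcl : IsClosed ((LinearMap.range f : Submodule ℝ G) : Set G) :=
    Submodule.closed_of_finiteDimensional _
  rw [Submodule.fg_iff_finiteDimensional]
  apply Submodule.finiteDimensional_of_le (S₂ := LinearMap.range f)
  rintro _ ⟨v, rfl⟩
  have : v ∈ closure (Set.range e) := he v
  have h2 := map_mem_closure (LinearMap.extendOfNorm f e).continuous this
    (t := ((LinearMap.range f : Submodule ℝ G) : Set G))
    (by rintro _ ⟨w, rfl⟩; exact ⟨w, (h1 w).symm⟩)
  rwa [hcl.closure_eq] at h2

end ext

section BM
variable {M : Type*} [AddCommGroup M] [Module ℝ M]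

lemma hb_seminorm (N : Seminorm ℝ M) (x : M) :
    ∃ φ : M →ₗ[ℝ] ℝ, (∀ y, |φ y| ≤ N y) ∧ φ x = N x := by
  by_cases hx0 : N x = 0
  · exact ⟨0, fun y => by simp, by simp [hx0]⟩
  have hx : x ≠ 0 := by rintro rfl; simp at hx0
  obtain ⟨g, hg1, hg2⟩ := exists_extension_of_le_sublinear
    (LinearPMap.mkSpanSingleton x (N x) hx) N
    (fun c hc y => by rw [map_smul_eq_mul, Real.norm_eq_abs, abs_of_pos hc])
    (map_add_le_add N) (by
      rintro ⟨y, hy⟩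
      obtain ⟨c, rfl⟩ := Submodule.mem_span_singleton.1 hy
      have e := LinearPMap.mkSpanSingleton'_apply x (N x) (fun c hc => by
        rcases smul_eq_zero.1 hc with h | h
        · simp [h]
        · exact absurd h hx) c hy
      refine e.le.trans ?_
      show c • N x ≤ N (c • x)
      rw [map_smul_eq_mul, smul_eq_mul]
      exact mul_le_mul_of_nonneg_right (le_abs_self c) (apply_nonneg _ _))
  refine ⟨g, fun y => abs_le.2 ⟨?_, hg2 y⟩, ?_⟩
  · have := hg2 (-y)
    rw [map_neg, map_neg_eq_map] at this
    linarith
  · exact (hg1 ⟨x, Submodule.mem_span_singleton_self (R := ℝ) x⟩).trans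
      (LinearPMap.mkSpanSingleton_apply ℝ ℝ hx (N x))

lemma BM (N : Seminorm ℝ M) (d : ℕ → M) (hd : ∀ x, ∀ ε > 0, ∃ i, N (x - d i) < ε) :
    ∃ Φ : M →ₗ[ℝ] CantorC, ∀ x, ‖Φ x‖ = N x := by
  let K : Set (M → ℝ) := {φ | (∀ x y, φ (x + y) = φ x + φ y) ∧ (∀ (r : ℝ) x, φ (r • x) = r * φ x) ∧
    ∀ x, φ x ∈ Set.Icc (-N x) (N x)}
  have hKc : IsCompact K := by
    have hpi : IsCompact (Set.pi Set.univ fun x : M => Set.Icc (-N x) (N x)) :=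
      isCompact_univ_pi fun x => isCompact_Icc
    apply hpi.of_isClosed_subset
    · have e : K = (⋂ x, ⋂ y, {φ : M → ℝ | φ (x + y) = φ x + φ y}) ∩
        ((⋂ r : ℝ, ⋂ x, {φ : M → ℝ | φ (r • x) = r * φ x}) ∩
        ⋂ x, {φ : M → ℝ | φ x ∈ Set.Icc (-N x) (N x)}) := by
        ext φ; simp [K]
      rw [e]
      refine IsClosed.inter ?_ (IsClosed.inter ?_ ?_)
      · exact isClosed_iInter fun x => isClosed_iInter fun y =>
          isClosed_eq (continuous_apply _) (by fun_prop)
      · exact isClosed_iInter fun r => isClosed_iInter fun y =>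
          isClosed_eq (continuous_apply _) ((continuous_apply _).const_mul _)
      · exact isClosed_iInter fun x => isClosed_Icc.preimage (continuous_apply x)
    · intro φ hφ x _
      exact hφ.2.2 x
  let res : (M → ℝ) → (ℕ → ℝ) := fun φ i => φ (d i)
  have hres : Continuous res := continuous_pi fun i => continuous_apply _
  let K' : Set (ℕ → ℝ) := res '' K
  have hK' : IsCompact K' := hKc.image hres
  have : CompactSpace K' := isCompact_iff_compactSpace.1 hK'
  have h0 : (0 : M → ℝ) ∈ K := by
    refine ⟨fun x y => by simp, fun r x => by simp, fun x => ?_⟩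
    have := apply_nonneg N x
    simp [this]
  have : Nonempty K' := ⟨⟨_, Set.mem_image_of_mem _ h0⟩⟩
  let : MetricSpace K' := TopologicalSpace.metrizableSpaceMetric K'
  obtain ⟨s, hs, hsurj⟩ := exists_nat_bool_continuous_surjective_of_compact K'
  have hch : ∀ c, ∃ φ ∈ K, res φ = (s c : ℕ → ℝ) := fun c => (s c).2
  choose φ hφK hφs using hch
  have happ : ∀ c x i, |φ c x - φ c (d i)| ≤ N (x - d i) := by
    intro c x i
    have h1 : φ c (x - d i) = φ c x - φ c (d i) := by
      rw [sub_eq_add_neg, (hφK c).1, ← neg_one_smul ℝ (d i), (hφK c).2.1]; ring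
    rw [← h1]
    exact abs_le.2 ((hφK c).2.2 _)
  have hcont : ∀ x, Continuous (fun c => φ c x) := by
    intro x
    rw [Metric.continuous_iff']
    intro c ε hε
    obtain ⟨i, hi⟩ := hd x (ε / 3) (by positivity)
    have hc : Continuous (fun c => φ c (d i)) := by
      have e : (fun c => φ c (d i)) = fun c => (s c : ℕ → ℝ) i := by
        ext c; rw [← hφs c]
      rw [e]
      exact (continuous_apply i).comp (continuous_subtype_val.comp hs)
    filter_upwards [(Metric.continuous_iff'.1 hc) c (ε / 3) (by positivity)] with b hb
    have h1 := happ b x i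
    have h2 := happ c x i
    rw [Real.dist_eq] at hb ⊢
    rw [abs_le] at h1 h2
    rw [abs_lt] at hb ⊢
    constructor <;> linarith [h1.1, h1.2, h2.1, h2.2, hb.1, hb.2]
  refine ⟨{ toFun := fun x => ⟨fun c => φ c x, hcont x⟩
            map_add' := fun x y => by ext c; exact (hφK c).1 x y
            map_smul' := fun r x => by ext c; exact (hφK c).2.1 r x }, fun x => ?_⟩
  apply le_antisymm
  · rw [ContinuousMap.norm_le _ (apply_nonneg _ _)]
    intro c
    exact abs_le.2 ((hφK c).2.2 x)
  · obtain ⟨ψ, hψ1, hψ2⟩ := hb_seminorm N x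
    have hψK : (ψ : M → ℝ) ∈ K :=
      ⟨fun x y => map_add ψ x y, fun r x => by simp, fun x => abs_le.1 (hψ1 x)⟩
    obtain ⟨c, hc⟩ := hsurj ⟨res ψ, Set.mem_image_of_mem _ hψK⟩
    have hcd : ∀ i, φ c (d i) = ψ (d i) := by
      intro i
      have := hφs c
      rw [hc] at this
      exact congrFun this i
    have hcx : N x ≤ φ c x := by
      apply le_of_forall_pos_le_add
      intro ε hε
      obtain ⟨i, hi⟩ := hd x (ε / 2) (by positivity)
      have h1 := abs_le.1 (happ c x i)
      have h2 := abs_le.1 (hψ1 (x - d i))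
      rw [map_sub ψ] at h2
      rw [hcd] at h1
      rw [← hψ2]
      linarith [h1.1, h1.2, h2.1, h2.2]
    refine hcx.trans ((le_abs_self _).trans ?_)
    exact ContinuousMap.norm_coe_le_norm (⟨fun c => φ c x, hcont x⟩ : CantorC) c

end BM
end NCX

open Filter Topology

namespace NCX

section lists

/-- The node of length `n` on the branch `σ`. -/
def br (σ : ℕ → ℕ) : ℕ → List ℕ
  | 0 => []
  | n + 1 => σ n :: br σ n

@[simp] lemma br_zero (σ : ℕ → ℕ) : br σ 0 = [] := rfl
lemma br_succ (σ : ℕ → ℕ) (n : ℕ) : br σ (n+1) = σ n :: br σ n := rfl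
@[simp] lemma br_length (σ : ℕ → ℕ) (n : ℕ) : (br σ n).length = n := by
  induction n with
  | zero => rfl
  | succ n ih => simp [br_succ, ih]

lemma br_suffix (σ : ℕ → ℕ) {m n : ℕ} (h : m ≤ n) : br σ m <:+ br σ n := by
  induction h with
  | refl => exact List.suffix_rfl
  | step _ ih => exact ih.trans (List.suffix_cons _ _)

lemma suffix_eq_of_length {l l' r : List ℕ} (h : l <:+ r) (h' : l' <:+ r)
    (hl : l.length = l'.length) : l = l' :=
  (List.suffix_of_suffix_length_le h h' hl.le).eq_of_length hl

lemma suffix_br {σ : ℕ → ℕ} {n : ℕ} {s : List ℕ} (h : s <:+ br σ n) : s = br σ s.length :=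
  suffix_eq_of_length h (br_suffix σ (by simpa using h.length_le)) (by simp)

/-- comparable nodes -/
def Comp (r s : List ℕ) : Prop := r <:+ s ∨ s <:+ r

lemma Comp.symm {r s : List ℕ} (h : Comp r s) : Comp s r := Or.symm h

lemma comp_of_suffix {r s u : List ℕ} (h : r <:+ u) (h' : s <:+ u) : Comp r s :=
  List.suffix_or_suffix_of_suffix h h'

lemma chain_branch (D : Set (List ℕ)) (hD : ∀ r ∈ D, ∀ s ∈ D, Comp r s) :
    ∃ σ : ℕ → ℕ, ∀ r ∈ D, r = br σ r.length := by
  have h : ∀ n, ∃ a, ∀ r ∈ D, n < r.length → ∀ l, l <:+ r → l.length = n → (a :: l) <:+ r := by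
    intro n
    by_cases hex : ∃ r0 ∈ D, n < r0.length
    · obtain ⟨r0, hr0, hn⟩ := hex
      obtain ⟨a, l0, hal, hl0⟩ : ∃ a l0, (a :: l0) <:+ r0 ∧ l0.length = n := by
        have h1 : (r0.drop (r0.length - (n+1))) <:+ r0 := List.drop_suffix _ _
        have h2 : (r0.drop (r0.length - (n+1))).length = n + 1 := by
          rw [List.length_drop]; omega
        match hh : r0.drop (r0.length - (n+1)) with
        | [] => simp [hh] at h2
        | a :: l0 => exact ⟨a, l0, hh ▸ h1, by simpa [hh] using h2⟩
      refine ⟨a, fun r hr hnr l hl hln => ?_⟩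
      rcases hD r hr r0 hr0 with h1 | h1
      · have : l = l0 := suffix_eq_of_length (hl.trans h1)
          ((List.suffix_cons a l0).trans hal) (by omega)
        rw [this]
        exact List.suffix_of_suffix_length_le hal h1 (by simp; omega)
      · have : l = l0 := suffix_eq_of_length hl
          (((List.suffix_cons a l0).trans hal).trans h1) (by omega)
        rw [this]
        exact hal.trans h1
    · push Not at hex
      exact ⟨0, fun r hr hn => absurd (hex r hr) (not_le.2 hn)⟩
  choose σ hσ using h
  refine ⟨σ, fun r hr => ?_⟩
  have key : ∀ k, k ≤ r.length → br σ k <:+ r := by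
    intro k
    induction k with
    | zero => intro _; exact List.nil_suffix
    | succ k ih =>
      intro hk
      exact hσ k r hr hk _ (ih (by omega)) (by simp)
  exact ((key r.length le_rfl).eq_of_length (by simp)).symm

/-- antichain -/
def AC (I : Finset (List ℕ)) : Prop := ∀ r ∈ I, ∀ s ∈ I, r ≠ s → ¬ Comp r s

lemma finite_branches (B : Set (List ℕ)) (M : ℕ)
    (hM : ∀ I : Finset (List ℕ), (∀ r ∈ I, r ∈ B) → AC I → I.card ≤ M) :
    ∃ Bs : Finset (ℕ → ℕ), ∀ r ∈ B, ∃ σ ∈ Bs, r = br σ r.length := by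
  classical
  let P : ℕ → Prop := fun n => ∃ I : Finset (List ℕ), (∀ r ∈ I, r ∈ B) ∧ AC I ∧ I.card = n
  have hP0 : P 0 := ⟨∅, by simp, by intro r hr; simp at hr, rfl⟩
  obtain ⟨I, hIB, hI, hIc⟩ : P (Nat.findGreatest P M) := Nat.findGreatest_spec (Nat.zero_le M) hP0
  have hmax : ∀ J : Finset (List ℕ), (∀ r ∈ J, r ∈ B) → AC J → J.card ≤ I.card := by
    intro J hJ1 hJ2
    rw [hIc]
    exact Nat.le_findGreatest (hM J hJ1 hJ2) ⟨J, hJ1, hJ2, rfl⟩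
  have hch : ∀ t ∈ I, ∀ r ∈ B, ∀ s ∈ B, t <:+ r → t <:+ s → Comp r s := by
    intro t ht r hr s hs htr hts
    by_contra hrs
    have key : ∀ q ∈ I.erase t, ∀ v, t <:+ v → ¬ Comp q v := by
      intro q hq v htv hqv
      have hqI := Finset.mem_of_mem_erase hq
      have hne := Finset.ne_of_mem_erase hq
      apply hI q hqI t ht hne
      rcases hqv with h | h
      · exact comp_of_suffix h htv
      · exact Or.inr (htv.trans h)
    have hrn : r ∉ I.erase t := fun h => key r h r htr (Or.inl List.suffix_rfl)
    have hsn : s ∉ I.erase t := fun h => key s h s hts (Or.inl List.suffix_rfl)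
    have hrs' : r ≠ s := by rintro rfl; exact hrs (Or.inl List.suffix_rfl)
    have := hmax (insert r (insert s (I.erase t))) (by
      intro q hq
      simp only [Finset.mem_insert] at hq
      rcases hq with rfl | rfl | hq
      · exact hr
      · exact hs
      · exact hIB q (Finset.mem_of_mem_erase hq)) (by
      intro q hq q' hq' hne hc
      simp only [Finset.mem_insert] at hq hq'
      rcases hq with rfl | rfl | hq <;> rcases hq' with rfl | rfl | hq'
      · exact hne rfl
      · exact hrs hc
      · exact key q' hq' _ htr hc.symm
      · exact hrs hc.symm
      · exact hne rfl
      · exact key q' hq' _ hts hc.symm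
      · exact key q hq _ htr hc
      · exact key q hq _ hts hc
      · exact hI q (Finset.mem_of_mem_erase hq) q' (Finset.mem_of_mem_erase hq') hne hc)
    rw [Finset.card_insert_of_notMem (by simp only [Finset.mem_insert, not_or]; exact ⟨hrs', hrn⟩),
      Finset.card_insert_of_notMem hsn, Finset.card_erase_of_mem ht] at this
    have : 0 < I.card := Finset.card_pos.2 ⟨t, ht⟩
    omega
  have hbr : ∀ t : List ℕ, ∃ σ, t ∈ I → ∀ r ∈ B, Comp r t → r = br σ r.length := by
    intro t
    by_cases ht : t ∈ I
    · obtain ⟨σ, hσ⟩ := chain_branch {r | r ∈ B ∧ Comp r t} (by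
        rintro r ⟨hr, hrt⟩ s ⟨hs, hst⟩
        rcases hrt with h | h <;> rcases hst with h' | h'
        · exact comp_of_suffix h h'
        · exact Or.inl (h.trans h')
        · exact Or.inr (h'.trans h)
        · exact hch t ht r hr s hs h h')
      exact ⟨σ, fun _ r hr hc => hσ r ⟨hr, hc⟩⟩
    · exact ⟨fun _ => 0, fun h => absurd h ht⟩
  choose g hg using hbr
  refine ⟨I.image g, fun r hr => ?_⟩
  by_contra hcon
  have hnc : ∀ t ∈ I, ¬ Comp r t := fun t ht hc =>
    hcon ⟨g t, Finset.mem_image_of_mem _ ht, hg t ht r hr hc⟩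
  have hrI : r ∉ I := fun h => hnc r h (Or.inl List.suffix_rfl)
  have := hmax (insert r I) (by
    intro q hq
    rcases Finset.mem_insert.1 hq with rfl | hq
    · exact hr
    · exact hIB q hq) (by
    intro q hq q' hq' hne hc
    rcases Finset.mem_insert.1 hq with h1 | h1 <;> rcases Finset.mem_insert.1 hq' with h2 | h2
    · exact hne (h1.trans h2.symm)
    · exact hnc q' h2 (h1 ▸ hc)
    · exact hnc q h1 (h2 ▸ hc.symm)
    · exact hI q h1 q' h2 hne hc)
  rw [Finset.card_insert_of_notMem hrI] at this
  omega

end lists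

section core
variable {X : Type*} [NormedAddCommGroup X] [NormedSpace ℝ X]
variable {G : Type*} [NormedAddCommGroup G] [NormedSpace ℝ G]

/-- nodes where `x` has a large piece beyond -/
def Bset (p : List ℕ → X →L[ℝ] G) (ε : ℝ) (x : X) : Set (List ℕ) :=
  {t | ∃ r u, t <:+ r ∧ r <:+ u ∧ ε < ‖p u x - p r.tail x‖}

lemma Bset_down {p : List ℕ → X →L[ℝ] G} {ε : ℝ} {x : X} {r t : List ℕ} (hr : r ∈ Bset p ε x)
    (ht : t <:+ r) : t ∈ Bset p ε x := by
  obtain ⟨r', u, h1, h2, h3⟩ := hr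
  exact ⟨r', u, ht.trans h1, h2, h3⟩

lemma lemW (p : List ℕ → X →L[ℝ] G) (hfr : ∀ u, (LinearMap.range (p u : X →ₗ[ℝ] G)).FG)
    (ε : ℝ) (M : ℕ) (hcount : ∀ x, ‖x‖ ≤ 1 → ∀ I : Finset (List ℕ), AC I →
      (∀ r ∈ I, ∃ u, r <:+ u ∧ ε < ‖p u x - p r.tail x‖) → I.card ≤ M)
    {S : Submodule ℝ X} (hS : InfD S) :
    ∃ w : ℕ → X, (∀ i, w i ∈ S ∧ ‖w i‖ = 1) ∧
      (∀ u, ∀ᶠ i in (hyperfilter ℕ : Filter ℕ), p u (w i) = 0) ∧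
      ∃ Bs : Finset (ℕ → ℕ), ∀ r, (∀ σ ∈ Bs, r ≠ br σ r.length) →
        ∀ᶠ i in (hyperfilter ℕ : Filter ℕ), r ∉ Bset p ε (w i) := by
  classical
  have hw : ∀ i : ℕ, ∃ w ∈ S, ‖w‖ = 1 ∧ ∀ k < i, p (Denumerable.ofNat (List ℕ) k) w = 0 := by
    intro i
    obtain ⟨S', h1, h2, h3⟩ := InfD.inf_kers (Finset.range i) hS
      (fun k => (p (Denumerable.ofNat (List ℕ) k) : X →ₗ[ℝ] G)) (fun k _ => hfr _)
    obtain ⟨x, hx, hx1⟩ := h2.exists_unit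
    exact ⟨x, h1 hx, hx1, fun k hk => h3 x hx k (Finset.mem_range.2 hk)⟩
  choose w hwS hw1 hw0 using hw
  refine ⟨w, fun i => ⟨hwS i, hw1 i⟩, ?_, ?_⟩
  · intro u
    apply Nat.hyperfilter_le_atTop
    filter_upwards [eventually_gt_atTop (Encodable.encode u)] with i hi
    have := hw0 i _ hi
    rwa [Denumerable.ofNat_encode] at this
  · obtain ⟨Bs, hBs⟩ := finite_branches
      {t | ∀ᶠ i in (hyperfilter ℕ : Filter ℕ), t ∈ Bset p ε (w i)}
      M (by
        intro I hI hAC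
        have h1 : ∀ᶠ i in (hyperfilter ℕ : Filter ℕ), ∀ t ∈ I, t ∈ Bset p ε (w i) :=
          (Finset.eventually_all I).2 hI
        obtain ⟨i, hi⟩ := h1.exists
        have h2 : ∀ t, ∃ r, t ∈ I → (t <:+ r ∧ ∃ u, r <:+ u ∧ ε < ‖p u (w i) - p r.tail (w i)‖) := by
          intro t
          by_cases ht : t ∈ I
          · obtain ⟨r, u, h1, h2, h3⟩ := hi t ht
            exact ⟨r, fun _ => ⟨h1, u, h2, h3⟩⟩
          · exact ⟨[], fun h => absurd h ht⟩
        choose g hg using h2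
        have hg' : ∀ t ∈ I, ∀ s ∈ I, t ≠ s → ¬ Comp (g t) (g s) := by
          intro t ht s hs hne hc
          apply hAC t ht s hs hne
          rcases hc with h | h
          · exact comp_of_suffix ((hg t ht).1.trans h) (hg s hs).1
          · exact comp_of_suffix (hg t ht).1 ((hg s hs).1.trans h)
        have hinj : Set.InjOn g I := by
          intro t ht s hs hts
          by_contra hne
          exact hg' t ht s hs hne (Or.inl (hts ▸ List.suffix_rfl))
        rw [← Finset.card_image_of_injOn hinj]
        refine hcount (w i) (hw1 i).le _ ?_ ?_
        · intro r hr s hs hne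
          obtain ⟨t, ht, rfl⟩ := Finset.mem_image.1 hr
          obtain ⟨t', ht', rfl⟩ := Finset.mem_image.1 hs
          exact hg' t ht t' ht' (fun h => hne (h ▸ rfl))
        · intro r hr
          obtain ⟨t, ht, rfl⟩ := Finset.mem_image.1 hr
          exact (hg t ht).2)
    refine ⟨Bs, fun r hr => ?_⟩
    refine Ultrafilter.eventually_not.2 ?_
    intro h
    obtain ⟨σ, hσ, he⟩ := hBs r h
    exact hr σ hσ he

theorem core (p : List ℕ → X →L[ℝ] G) {S₀ : Submodule ℝ X} (hS₀ : InfD S₀)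
    (hfr : ∀ u, (LinearMap.range (p u : X →ₗ[ℝ] G)).FG)
    (K : ℝ) (hK : ∀ u x, ‖p u x‖ ≤ K * ‖x‖)
    (hmono : ∀ u v x, v <:+ u → ‖p v x‖ ≤ ‖p u x‖)
    (hfin : ∀ x, ∀ ε > 0, (Bset p ε x).Finite)
    (hcount : ∀ ε > 0, ∀ C, ∃ M : ℕ, ∀ x, ‖x‖ ≤ C → ∀ I : Finset (List ℕ), AC I →
      (∀ r ∈ I, ∃ u, r <:+ u ∧ ε < ‖p u x - p r.tail x‖) → I.card ≤ M)
    (c : ℝ) (hc : 0 < c) (hcx : ∀ x, ∃ u, c * ‖x‖ ≤ ‖p u x‖) :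
    ∃ σ, ∃ S ≤ S₀, InfD S ∧ ∃ δ > 0, ∀ x ∈ S, ‖x‖ = 1 → ∃ n, δ < ‖p (br σ n) x‖ := by
  classical
  by_contra! hnot
  obtain ⟨M, hM⟩ := hcount (c / 8) (by positivity) ((K + c) / c)
  set N : ℕ := M + 1 with hN
  have hNpos : (0:ℝ) < N := by rw [hN]; positivity
  set ε : ℝ := c / (32 * N) with hεdef
  have hε : 0 < ε := by positivity
  have hεN : ε * N = c / 32 := by rw [hεdef]; field_simp
  have hεc : ε ≤ c / 32 := by
    rw [← hεN]
    have : (1:ℝ) ≤ N := by rw [hN]; push_cast; linarith [(Nat.cast_nonneg M : (0:ℝ) ≤ M)]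
    nlinarith
  obtain ⟨M', hM'⟩ := hcount ε hε 1
  have hbranch : ∀ (Bs : Finset (ℕ → ℕ)) (S : Submodule ℝ X), S ≤ S₀ → InfD S →
      ∃ S' ≤ S, InfD S' ∧ ∀ x ∈ S', ∀ σ ∈ Bs, ∀ n, ‖p (br σ n) x‖ ≤ ε * ‖x‖ := by
    intro Bs S hSS hS
    induction Bs using Finset.induction_on with
    | empty => exact ⟨S, le_rfl, hS, by simp⟩
    | insert σ Bs _ ih =>
      obtain ⟨S', h1, h2, h3⟩ := ih
      obtain ⟨S'', h4, h5, h6⟩ := lemS (fun n => p (br σ n)) h2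
        (fun T hT hTI δ hδ => hnot σ T (hT.trans (h1.trans hSS)) hTI δ hδ) ε hε
      refine ⟨S'', h4.trans h1, h5, fun x hx τ hτ n => ?_⟩
      rcases Finset.mem_insert.1 hτ with rfl | hτ
      · exact h6 x hx n
      · exact h3 x (h4 hx) τ hτ n
  let R : X → Set (List ℕ) := fun x => {r | r ∈ Bset p ε x ∧ ε < ‖p r x‖}
  let Rel : X → X → Prop := fun b a => ∀ r ∈ R a, (∀ s, s <:+ r → p s b = 0) ∧ r ∉ Bset p ε b
  have hP : ∀ n : ℕ, ∀ S ≤ S₀, InfD S → ∃ l : List X, l.length = n ∧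
      (∀ z ∈ l, z ∈ S ∧ ‖z‖ = 1 ∧ p [] z = 0) ∧ l.Pairwise Rel := by
    intro n
    induction n with
    | zero => intro S _ _; exact ⟨[], rfl, by simp, List.Pairwise.nil⟩
    | succ n ih =>
      intro S hSS hS
      obtain ⟨w, hw1, hw2, Bs, hBs⟩ := lemW p hfr ε M' hM' hS
      obtain ⟨S', h1, h2, h3⟩ := hbranch Bs S hSS hS
      obtain ⟨l, hl1, hl2, hl3⟩ := ih S' (h1.trans hSS) h2
      have hev : ∀ a ∈ l, ∀ᶠ i in (hyperfilter ℕ : Filter ℕ), Rel (w i) a := by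
        intro a ha
        have hfinR : (R a).Finite := (hfin a ε hε).subset fun r hr => hr.1
        refine (Set.Finite.eventually_all hfinR).2 ?_
        intro r hr
        refine Filter.Eventually.and ?_ ?_
        · have : {s | s <:+ r}.Finite := by
            apply (List.finite_toSet r.tails).subset
            intro s hs
            exact (List.mem_tails s r).2 hs
          exact (Set.Finite.eventually_all this).2 fun s _ => hw2 s
        · apply hBs
          intro σ hσ he
          have h4 := h3 a (hl2 a ha).1 σ hσ r.length
          rw [← he, (hl2 a ha).2.1, mul_one] at h4
          exact absurd hr.2 (not_lt.2 h4)
      have hev2 : ∀ᶠ i in (hyperfilter ℕ : Filter ℕ), ∀ a ∈ l, Rel (w i) a := by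
        have := (Set.Finite.eventually_all (List.finite_toSet l)
          (l := (hyperfilter ℕ : Filter ℕ)) (p := fun a i => Rel (w i) a)).2 hev
        exact this
      obtain ⟨i, hi1, hi2⟩ := (hev2.and (hw2 [])).exists
      refine ⟨w i :: l, by simp [hl1], ?_, List.pairwise_cons.2 ⟨hi1, hl3⟩⟩
      intro z hz
      rcases List.mem_cons.1 hz with rfl | hz
      · exact ⟨(hw1 i).1, (hw1 i).2, hi2⟩
      · exact ⟨h1 (hl2 z hz).1, (hl2 z hz).2⟩
  obtain ⟨l, hl1, hl2, hl3⟩ := hP N S₀ le_rfl hS₀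
  have hinc : ∀ a b, Rel b a → ∀ r ∈ R a, ∀ s ∈ R b, ¬ Comp r s := by
    intro a b hab r hr s hs hcmp
    obtain ⟨h1, h2⟩ := hab r hr
    rcases hcmp with h | h
    · exact h2 (Bset_down hs.1 h)
    · have := h1 s h
      have h3 := hs.2
      rw [this, norm_zero] at h3
      linarith
  let z : Fin N → X := fun i => l.get (i.cast hl1.symm)
  have hz : ∀ i, ‖z i‖ = 1 ∧ p [] (z i) = 0 := fun i => (hl2 _ (List.get_mem _ _)).2
  have hzinc : ∀ i j, i ≠ j → ∀ r ∈ R (z i), ∀ s ∈ R (z j), ¬ Comp r s := by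
    intro i j hij r hr s hs hcmp
    rcases lt_or_gt_of_ne hij with h | h
    · exact hinc (z j) (z i) (List.pairwise_iff_get.1 hl3 _ _ h) s hs r hr hcmp.symm
    · exact hinc (z i) (z j) (List.pairwise_iff_get.1 hl3 _ _ h) r hr s hs hcmp
  have hF0 : ∀ x, p [] x = 0 → ∀ u, ε < ‖p u x‖ →
      ∃ r, r <:+ u ∧ ε < ‖p r x‖ ∧ ‖p r.tail x‖ ≤ ε := by
    intro x hx u
    induction u with
    | nil => intro h; rw [hx, norm_zero] at h; linarith
    | cons a l ih =>
      intro h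
      by_cases hl : ε < ‖p l x‖
      · obtain ⟨r, h1, h2⟩ := ih hl
        exact ⟨r, h1.trans (List.suffix_cons _ _), h2⟩
      · exact ⟨a :: l, List.suffix_rfl, h, not_lt.1 hl⟩
  have hF : ∀ i u, 2 * ε < ‖p u (z i)‖ → ∃ r, r <:+ u ∧ r ∈ R (z i) ∧ ‖p r.tail (z i)‖ ≤ ε := by
    intro i u hu
    obtain ⟨r, h1, h2, h3⟩ := hF0 (z i) (hz i).2 u (by linarith)
    refine ⟨r, h1, ⟨⟨r, u, List.suffix_rfl, h1, ?_⟩, h2⟩, h3⟩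
    have := norm_sub_norm_le (p u (z i)) (p r.tail (z i))
    linarith
  have hone : ∀ u i j, i ≠ j → 2 * ε < ‖p u (z i)‖ → ‖p u (z j)‖ ≤ 2 * ε := by
    intro u i j hij hi
    by_contra! hj
    obtain ⟨r, h1, h2, _⟩ := hF i u hi
    obtain ⟨s, h3, h4, _⟩ := hF j u hj
    exact hzinc i j hij r h2 s h4 (comp_of_suffix h1 h3)
  have hsumle : ∀ u i, (∀ j, j ≠ i → ‖p u (z j)‖ ≤ 2 * ε) →
      ∑ j ∈ Finset.univ.erase i, ‖p u (z j)‖ ≤ c / 16 := by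
    intro u i hj
    calc ∑ j ∈ Finset.univ.erase i, ‖p u (z j)‖
        ≤ ∑ j ∈ Finset.univ.erase i, 2 * ε := Finset.sum_le_sum fun j hj' =>
          hj j (Finset.ne_of_mem_erase hj')
      _ ≤ ∑ j : Fin N, 2 * ε := Finset.sum_le_sum_of_subset_of_nonneg (Finset.erase_subset _ _)
          (fun _ _ _ => by positivity)
      _ = c / 16 := by
          rw [Finset.sum_const, Finset.card_univ, Fintype.card_fin, nsmul_eq_mul]
          linarith
  set y : X := ∑ j, z j with hy
  have hpy : ∀ u i, p u y = p u (z i) + ∑ j ∈ Finset.univ.erase i, p u (z j) := by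
    intro u i
    rw [hy, map_sum]
    exact (Finset.add_sum_erase _ (fun j => p u (z j)) (Finset.mem_univ i)).symm
  have hyu : ∀ u, ‖p u y‖ ≤ K + c := by
    intro u
    obtain ⟨i, hi⟩ : ∃ i, ∀ j, j ≠ i → ‖p u (z j)‖ ≤ 2 * ε := by
      by_cases hex : ∃ i, 2 * ε < ‖p u (z i)‖
      · obtain ⟨i, hi⟩ := hex
        exact ⟨i, fun j hj => hone u i j hj.symm hi⟩
      · push Not at hex
        exact ⟨⟨0, by omega⟩, fun j _ => hex j⟩
    rw [hpy u i]
    refine (norm_add_le _ _).trans ?_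
    have h1 := hK u (z i)
    rw [(hz i).1, mul_one] at h1
    have h2 := (norm_sum_le (Finset.univ.erase i) fun j => p u (z j)).trans (hsumle u i hi)
    linarith
  have hyn : ‖y‖ ≤ (K + c) / c := by
    obtain ⟨u, hu⟩ := hcx y
    rw [le_div_iff₀ hc]
    linarith [hyu u]
  have hsel : ∀ i, ∃ r, r ∈ R (z i) ∧ ∃ u, r <:+ u ∧ c / 8 < ‖p u y - p r.tail y‖ := by
    intro i
    obtain ⟨u, hu⟩ := hcx (z i)
    rw [(hz i).1, mul_one] at hu
    have hu2 : 2 * ε < ‖p u (z i)‖ := by linarith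
    obtain ⟨r, h1, h2, h3⟩ := hF i u hu2
    refine ⟨r, h2, u, h1, ?_⟩
    have hrt : r.tail <:+ u := (List.tail_suffix r).trans h1
    have h4 := hsumle u i (fun j hj => hone u i j hj.symm hu2)
    have h5 := hsumle r.tail i (fun j hj => (hmono u _ _ hrt).trans (hone u i j hj.symm hu2))
    rw [hpy u i, hpy r.tail i]
    have h6 := (norm_sum_le (Finset.univ.erase i) fun j => p u (z j)).trans h4
    have h7 := (norm_sum_le (Finset.univ.erase i) fun j => p r.tail (z j)).trans h5
    set s1 := ∑ j ∈ Finset.univ.erase i, p u (z j)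
    set s2 := ∑ j ∈ Finset.univ.erase i, p r.tail (z j)
    have h8 : p u (z i) = (p u (z i) + s1 - (p r.tail (z i) + s2)) + p r.tail (z i) - s1 + s2 := by
      abel
    have h9 : ‖p u (z i)‖ ≤ ‖p u (z i) + s1 - (p r.tail (z i) + s2)‖ + ‖p r.tail (z i)‖ + ‖s1‖ +
        ‖s2‖ := by
      conv_lhs => rw [h8]
      exact (norm_add_le _ _).trans (add_le_add_left ((norm_sub_le _ _).trans
        (add_le_add_left (norm_add_le _ _) _)) _)
    linarith
  choose r hrR hru using hsel
  have hinj : Function.Injective r := by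
    intro i j hij
    by_contra hne
    exact hzinc i j hne _ (hrR i) _ (hrR j) (Or.inl (hij ▸ List.suffix_rfl))
  have := hM y hyn (Finset.univ.image r) (by
    intro a ha b hb hab
    obtain ⟨i, _, rfl⟩ := Finset.mem_image.1 ha
    obtain ⟨j, _, rfl⟩ := Finset.mem_image.1 hb
    exact hzinc i j (fun h => hab (h ▸ rfl)) _ (hrR i) _ (hrR j)) (by
    intro a ha
    obtain ⟨i, _, rfl⟩ := Finset.mem_image.1 ha
    exact hru i)
  rw [Finset.card_image_of_injective _ hinj, Finset.card_univ, Fintype.card_fin] at this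
  omega

end core
end NCX

open Filter Topology

namespace NCX

section meet

/-- longest common suffix -/
def meet (u : List ℕ) : List ℕ → List ℕ
  | [] => []
  | a :: l => if (a :: l) <:+ u then a :: l else meet u l

lemma meet_suffix_right (u t : List ℕ) : meet u t <:+ t := by
  induction t with
  | nil => exact List.suffix_rfl
  | cons a l ih =>
    rw [meet]; split_ifs with h
    · exact List.suffix_rfl
    · exact ih.trans (List.suffix_cons _ _)

lemma meet_suffix_left (u t : List ℕ) : meet u t <:+ u := by
  induction t with
  | nil => exact List.nil_suffix
  | cons a l ih =>
    rw [meet]; split_ifs with h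
    · exact h
    · exact ih

lemma suffix_meet {u t s : List ℕ} (h1 : s <:+ u) (h2 : s <:+ t) : s <:+ meet u t := by
  induction t with
  | nil => exact h2
  | cons a l ih =>
    rw [meet]; split_ifs with h
    · exact h2
    · rcases List.suffix_cons_iff.1 h2 with h3 | h3
      · exact absurd (h3 ▸ h1) h
      · exact ih h3

lemma suffix_antisymm {s t : List ℕ} (h1 : s <:+ t) (h2 : t <:+ s) : s = t :=
  h1.eq_of_length (le_antisymm h1.length_le h2.length_le)

lemma meet_eq_self {u t : List ℕ} (h : t <:+ u) : meet u t = t :=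
  suffix_antisymm (meet_suffix_right _ _) (suffix_meet h List.suffix_rfl)

lemma meet_meet {u v : List ℕ} (h : v <:+ u) (t : List ℕ) : meet v (meet u t) = meet v t :=
  suffix_antisymm
    (suffix_meet (meet_suffix_left _ _) ((meet_suffix_right _ _).trans (meet_suffix_right _ _)))
    (suffix_meet (meet_suffix_left _ _)
      (suffix_meet ((meet_suffix_left _ _).trans h) (meet_suffix_right _ _)))

lemma meet_le_meet {u v : List ℕ} (h : v <:+ u) (t : List ℕ) : meet v t <:+ meet u t :=
  suffix_meet ((meet_suffix_left _ _).trans h) (meet_suffix_right _ _)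

lemma suffix_tail_of_ne {s r : List ℕ} (h : s <:+ r) (hne : s ≠ r) : s <:+ r.tail := by
  cases r with
  | nil => exact absurd (List.suffix_nil.1 h) hne
  | cons a l =>
    rcases List.suffix_cons_iff.1 h with h | h
    · exact absurd h hne
    · exact h

/-- if `t` does not pass through `r`, then the projections agree -/
lemma meet_eq_tail {r u t : List ℕ} (hru : r <:+ u) (hrt : ¬ r <:+ t) :
    meet u t = meet r.tail t := by
  refine suffix_antisymm (suffix_meet ?_ (meet_suffix_right _ _))
    (meet_le_meet ((List.tail_suffix r).trans hru) t)
  rcases comp_of_suffix (meet_suffix_left u t) hru with h | h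
  · refine suffix_tail_of_ne h ?_
    intro he
    exact hrt (he ▸ meet_suffix_right u t)
  · exact absurd (h.trans (meet_suffix_right _ _)) hrt

/-- projection to a branch -/
def msig (σ : ℕ → ℕ) : List ℕ → List ℕ
  | [] => []
  | a :: l => if (a :: l) = br σ (l.length + 1) then a :: l else msig σ l

lemma meet_br (σ : ℕ → ℕ) (t : List ℕ) (m : ℕ) (hm : t.length ≤ m) : meet (br σ m) t = msig σ t := by
  induction t with
  | nil => rfl
  | cons a l ih =>
    rw [List.length_cons] at hm
    rw [meet, msig, ih (by omega)]
    have : ((a :: l) <:+ br σ m) ↔ (a :: l) = br σ (l.length + 1) := by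
      constructor
      · intro h; simpa using suffix_br h
      · intro h; rw [h]; exact br_suffix σ hm
    simp only [this]

/-- admissible maps on nodes -/
def Adm (μ : List ℕ → List ℕ) : Prop :=
  ∀ a l, (μ (a :: l) = a :: l ∧ μ l = l) ∨ μ (a :: l) = μ l

lemma adm_meet (u : List ℕ) : Adm (meet u) := by
  intro a l
  by_cases h : (a :: l) <:+ u
  · exact Or.inl ⟨meet_eq_self h, meet_eq_self ((List.suffix_cons _ _).trans h)⟩
  · right; rw [meet, if_neg h]

lemma adm_msig (σ : ℕ → ℕ) : Adm (msig σ) := by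
  intro a l
  rw [← meet_br σ (a :: l) (l.length + 1) (by simp), ← meet_br σ l (l.length + 1) (by simp)]
  exact adm_meet _ a l

end meet

/-- Data for the tree space. -/
structure TD (E : Type) [NormedAddCommGroup E] [NormedSpace ℝ E] where
  /-- projections -/
  ρ : ℕ → E →ₗ[ℝ] E
  /-- subspaces -/
  F : List ℕ → Submodule ℝ E
  ρ_norm : ∀ n x, ‖ρ n x‖ ≤ ‖x‖
  ρ_comp : ∀ m n x, m ≤ n → ρ m (ρ n x) = ρ m x
  ρ_fg : ∀ n, (LinearMap.range (ρ n)).FG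
  F_fix : ∀ t f, f ∈ F t → ρ t.length f = f
  F_mono : ∀ a l, F l ≤ F (a :: l)

section tree
variable {E : Type} [NormedAddCommGroup E] [NormedSpace ℝ E]

/-- the `ℓ₁`-sum seminorm -/
noncomputable def L1 : Seminorm ℝ (List ℕ →₀ E) :=
  Seminorm.ofSMulLE (fun x => x.sum fun _ v => ‖v‖) (by simp) (by
    classical
    intro x y
    rw [Finsupp.sum_of_support_subset x (Finset.subset_union_left (s₂ := y.support)) _ (by simp),
      Finsupp.sum_of_support_subset y (Finset.subset_union_right (s₁ := x.support)) _ (by simp),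
      Finsupp.sum_of_support_subset (x + y) Finsupp.support_add _ (by simp),
      ← Finset.sum_add_distrib]
    exact Finset.sum_le_sum fun t _ => norm_add_le _ _) (by
    intro c x
    rw [Finsupp.sum_of_support_subset (c • x) Finsupp.support_smul _ (by simp),
      Finsupp.sum, Finset.mul_sum]
    exact Finset.sum_le_sum fun t _ => by simp [norm_smul])

lemma L1_apply (x : List ℕ →₀ E) : L1 x = x.sum fun _ v => ‖v‖ := rfl

@[simp] lemma L1_single (t : List ℕ) (h : E) : L1 (Finsupp.single t h) = ‖h‖ := by
  simp [L1_apply]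

lemma seminorm_sum_le {M : Type*} [AddCommGroup M] [Module ℝ M] (q : Seminorm ℝ M) {ι : Type*}
    (s : Finset ι) (f : ι → M) : q (∑ i ∈ s, f i) ≤ ∑ i ∈ s, q (f i) :=
  Finset.le_sum_of_subadditive q (map_zero q).le (map_add_le_add q) _ _

lemma seminorm_sum_apply {M : Type*} [AddCommGroup M] [Module ℝ M] {ι : Type*}
    (s : Finset ι) (q : ι → Seminorm ℝ M) (x : M) : (∑ i ∈ s, q i) x = ∑ i ∈ s, q i x := by
  classical
  induction s using Finset.induction_on with
  | empty => simp
  | insert a s ha ih => rw [Finset.sum_insert ha, Finset.sum_insert ha, Seminorm.add_apply, ih]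

lemma L1_bound (q : Seminorm ℝ (List ℕ →₀ E)) (C : ℝ)
    (h : ∀ t h, q (Finsupp.single t h) ≤ C * ‖h‖) (x : List ℕ →₀ E) : q x ≤ C * L1 x := by
  conv_lhs => rw [← Finsupp.sum_single x]
  rw [Finsupp.sum, L1_apply, Finsupp.sum, Finset.mul_sum]
  exact (seminorm_sum_le q _ _).trans (Finset.sum_le_sum fun t _ => h t _)

lemma L1_dense [TopologicalSpace.SeparableSpace E] :
    ∃ d : ℕ → (List ℕ →₀ E), ∀ x, ∀ ε > 0, ∃ i, L1 (x - d i) < ε := by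
  classical
  let e : ℕ → E := TopologicalSpace.denseSeq E
  let D : List (List ℕ × ℕ) → (List ℕ →₀ E) :=
    fun l => (l.map fun p => Finsupp.single p.1 (e p.2)).sum
  refine ⟨fun i => D (Denumerable.ofNat _ i), fun x => ?_⟩
  suffices h : ∀ ε > 0, ∃ l, L1 (x - D l) < ε by
    intro ε hε
    obtain ⟨l, hl⟩ := h ε hε
    exact ⟨Encodable.encode l, by
      show L1 (x - D (Denumerable.ofNat _ (Encodable.encode l))) < ε
      rwa [Denumerable.ofNat_encode]⟩
  induction x using Finsupp.induction_linear with
  | zero => intro ε hε; exact ⟨[], by simpa [D] using hε⟩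
  | add x y hx hy =>
    intro ε hε
    obtain ⟨l, hl⟩ := hx (ε / 2) (by positivity)
    obtain ⟨l', hl'⟩ := hy (ε / 2) (by positivity)
    refine ⟨l ++ l', ?_⟩
    have e1 : x + y - D (l ++ l') = (x - D l) + (y - D l') := by simp [D]; abel
    rw [e1]
    linarith [map_add_le_add (L1 (E := E)) (x - D l) (y - D l')]
  | single t v =>
    intro ε hε
    obtain ⟨i, hi⟩ := (TopologicalSpace.denseRange_denseSeq E).exists_dist_lt v hε
    refine ⟨[(t, i)], ?_⟩
    simp only [D, List.map_cons, List.map_nil, List.sum_cons, List.sum_nil, add_zero]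
    rw [← Finsupp.single_sub, L1_single, ← dist_eq_norm]
    exact hi

namespace TD
variable (D : TD E)

/-- the gluing relations -/
noncomputable def R : Submodule ℝ (List ℕ →₀ E) :=
  Submodule.span ℝ {x | ∃ a l, ∃ f ∈ D.F l, x = Finsupp.single (a :: l) f - Finsupp.single l f}

lemma gen_mem {a : ℕ} {l : List ℕ} {f : E} (hf : f ∈ D.F l) :
    Finsupp.single (a :: l) f - Finsupp.single l f ∈ D.R :=
  Submodule.subset_span ⟨a, l, f, hf, rfl⟩

lemma bddB (x : List ℕ →₀ E) : BddBelow (Set.range fun r : D.R => L1 (x - (r : List ℕ →₀ E))) :=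
  ⟨0, by rintro _ ⟨r, rfl⟩; exact apply_nonneg _ _⟩

lemma ncF_lt (x : List ℕ →₀ E) {ε : ℝ} (hε : 0 < ε) :
    ∃ r ∈ D.R, L1 (x - r) < (⨅ r : D.R, L1 (x - (r : List ℕ →₀ E))) + ε := by
  obtain ⟨r, hr⟩ := exists_lt_of_ciInf_lt (lt_add_of_pos_right (⨅ r : D.R, L1 (x - (r : List ℕ →₀ E))) hε)
  exact ⟨r, r.2, hr⟩

/-- the quotient seminorm -/
noncomputable def NC : Seminorm ℝ (List ℕ →₀ E) :=
  Seminorm.ofSMulLE (fun x => ⨅ r : D.R, L1 (x - (r : List ℕ →₀ E))) (by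
    apply le_antisymm
    · exact (ciInf_le (D.bddB 0) (0 : D.R)).trans (by simp)
    · exact le_ciInf fun r => apply_nonneg _ _) (by
    intro x y
    apply le_of_forall_pos_le_add
    intro ε hε
    obtain ⟨r, hr, h1⟩ := D.ncF_lt x (half_pos hε)
    obtain ⟨s, hs, h2⟩ := D.ncF_lt y (half_pos hε)
    refine (ciInf_le (D.bddB _) (⟨r + s, D.R.add_mem hr hs⟩ : D.R)).trans ?_
    have e : x + y - (r + s) = (x - r) + (y - s) := by abel
    show L1 (x + y - (r + s)) ≤ _
    rw [e]
    linarith [map_add_le_add (L1 (E := E)) (x - r) (y - s)]) (by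
    intro c x
    apply le_of_forall_pos_le_add
    intro ε hε
    obtain ⟨r, hr, h1⟩ := D.ncF_lt x (ε := ε / (‖c‖ + 1)) (by positivity)
    refine (ciInf_le (D.bddB _) (⟨c • r, D.R.smul_mem c hr⟩ : D.R)).trans ?_
    show L1 (c • x - c • r) ≤ _
    rw [← smul_sub, map_smul_eq_mul]
    have h2 : ‖c‖ * L1 (x - r) ≤ ‖c‖ * ((⨅ r : D.R, L1 (x - (r : List ℕ →₀ E))) + ε / (‖c‖ + 1)) :=
      mul_le_mul_of_nonneg_left h1.le (norm_nonneg _)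
    have h3 : ‖c‖ * (ε / (‖c‖ + 1)) ≤ ε := by
      rw [← mul_div_assoc, div_le_iff₀ (by positivity)]
      nlinarith [norm_nonneg c]
    rw [mul_add] at h2
    linarith)

lemma NC_le (x : List ℕ →₀ E) {r : List ℕ →₀ E} (hr : r ∈ D.R) : D.NC x ≤ L1 (x - r) :=
  ciInf_le (D.bddB x) (⟨r, hr⟩ : D.R)

lemma NC_le_L1 (x : List ℕ →₀ E) : D.NC x ≤ L1 x := by
  simpa using D.NC_le x D.R.zero_mem

lemma NC_lt (x : List ℕ →₀ E) {ε : ℝ} (hε : 0 < ε) : ∃ r ∈ D.R, L1 (x - r) < D.NC x + ε :=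
  D.ncF_lt x hε

lemma NC_R {r : List ℕ →₀ E} (hr : r ∈ D.R) : D.NC r = 0 :=
  le_antisymm ((D.NC_le r hr).trans (by simp)) (apply_nonneg _ _)

lemma q_R (q : Seminorm ℝ (List ℕ →₀ E))
    (hR : ∀ a l, ∀ f ∈ D.F l, q (Finsupp.single (a :: l) f - Finsupp.single l f) = 0)
    {r : List ℕ →₀ E} (hr : r ∈ D.R) : q r = 0 := by
  induction hr using Submodule.span_induction with
  | mem x hx => obtain ⟨a, l, f, hf, rfl⟩ := hx; exact hR a l f hf
  | zero => exact map_zero q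
  | add x y _ _ hx hy =>
    exact le_antisymm ((map_add_le_add q x y).trans (by simp [hx, hy])) (apply_nonneg _ _)
  | smul c x _ hx => rw [map_smul_eq_mul, hx, mul_zero]

lemma NC_bound (q : Seminorm ℝ (List ℕ →₀ E)) (C : ℝ) (hC : 0 ≤ C)
    (h : ∀ t h, q (Finsupp.single t h) ≤ C * ‖h‖)
    (hR : ∀ a l, ∀ f ∈ D.F l, q (Finsupp.single (a :: l) f - Finsupp.single l f) = 0)
    (x : List ℕ →₀ E) : q x ≤ C * D.NC x := by
  apply le_of_forall_pos_le_add
  intro ε hε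
  obtain ⟨r, hr, h1⟩ := D.NC_lt x (ε := ε / (C + 1)) (by positivity)
  have h2 := L1_bound q C h (x - r)
  have h3 : q x ≤ q (x - r) + q r := by
    simpa using map_add_le_add q (x - r) r
  rw [D.q_R q hR hr] at h3
  have h4 : C * L1 (x - r) ≤ C * (D.NC x + ε / (C + 1)) := mul_le_mul_of_nonneg_left h1.le hC
  have h5 : C * (ε / (C + 1)) ≤ ε := by
    rw [← mul_div_assoc, div_le_iff₀ (by positivity)]; nlinarith
  rw [mul_add] at h4
  linarith

/-- the projections -/
noncomputable def P (μ : List ℕ → List ℕ) : (List ℕ →₀ E) →ₗ[ℝ] (List ℕ →₀ E) :=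
  Finsupp.lsum ℝ fun t => (Finsupp.lsingle (μ t)) ∘ₗ D.ρ (μ t).length

@[simp] lemma P_single (μ : List ℕ → List ℕ) (t : List ℕ) (h : E) :
    D.P μ (Finsupp.single t h) = Finsupp.single (μ t) (D.ρ (μ t).length h) := by
  simp [P]

lemma P_R {μ : List ℕ → List ℕ} (hμ : Adm μ) {r : List ℕ →₀ E} (hr : r ∈ D.R) :
    D.P μ r ∈ D.R := by
  induction hr using Submodule.span_induction with
  | mem x hx =>
    obtain ⟨a, l, f, hf, rfl⟩ := hx
    rw [map_sub, P_single, P_single]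
    rcases hμ a l with ⟨h1, h2⟩ | h1
    · rw [h1, h2, D.F_fix l f hf, D.F_fix (a :: l) f (D.F_mono a l hf)]
      exact D.gen_mem hf
    · rw [h1, sub_self]; exact D.R.zero_mem
  | zero => rw [map_zero]; exact D.R.zero_mem
  | add x y _ _ hx hy => rw [map_add]; exact D.R.add_mem hx hy
  | smul c x _ hx => rw [map_smul]; exact D.R.smul_mem _ hx

lemma NC_single_le (t : List ℕ) (h : E) : D.NC (Finsupp.single t h) ≤ ‖h‖ :=
  (D.NC_le_L1 _).trans (by simp)

lemma P_NC {μ : List ℕ → List ℕ} (hμ : Adm μ) (x : List ℕ →₀ E) : D.NC (D.P μ x) ≤ D.NC x := by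
  have := D.NC_bound (D.NC.comp (D.P μ)) 1 zero_le_one (by
    intro t h
    rw [Seminorm.comp_apply, P_single, one_mul]
    exact (D.NC_single_le _ _).trans (D.ρ_norm _ _)) (by
    intro a l f hf
    rw [Seminorm.comp_apply]
    exact D.NC_R (D.P_R hμ (D.gen_mem hf))) x
  rwa [one_mul] at this

lemma P_comp {u v : List ℕ} (h : v <:+ u) (x : List ℕ →₀ E) :
    D.P (meet v) (D.P (meet u) x) = D.P (meet v) x := by
  induction x using Finsupp.induction_linear with
  | zero => simp
  | add x y hx hy => simp [hx, hy]
  | single t f =>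
    rw [P_single, P_single, P_single, meet_meet h, D.ρ_comp _ _ _ (meet_le_meet h t).length_le]

lemma P_mono {u v : List ℕ} (h : v <:+ u) (x : List ℕ →₀ E) :
    D.NC (D.P (meet v) x) ≤ D.NC (D.P (meet u) x) := by
  rw [← D.P_comp h x]; exact D.P_NC (adm_meet v) _

lemma P_br (σ : ℕ → ℕ) (x : List ℕ →₀ E) :
    ∃ m₀, ∀ m ≥ m₀, D.P (meet (br σ m)) x = D.P (msig σ) x := by
  induction x using Finsupp.induction_linear with
  | zero => exact ⟨0, by simp⟩
  | add x y hx hy =>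
    obtain ⟨m, hm⟩ := hx
    obtain ⟨m', hm'⟩ := hy
    exact ⟨max m m', fun k hk => by
      rw [map_add, map_add, hm k (le_trans (le_max_left _ _) hk),
        hm' k (le_trans (le_max_right _ _) hk)]⟩
  | single t f =>
    exact ⟨t.length, fun m hm => by rw [P_single, P_single, meet_br σ t m hm]⟩

/-- differences vanish on nodes not passing through `r` -/
lemma P_diff {r u : List ℕ} (hru : r <:+ u) (x : List ℕ →₀ E) (hx : ∀ t ∈ x.support, ¬ r <:+ t) :
    D.P (meet u) x = D.P (meet r.tail) x := by
  rw [← Finsupp.sum_single x, Finsupp.sum, map_sum, map_sum]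
  refine Finset.sum_congr rfl fun t ht => ?_
  rw [P_single, P_single, meet_eq_tail hru (hx t ht)]

lemma P_count (I : Finset (List ℕ)) (hI : AC I) (u : List ℕ → List ℕ) (hu : ∀ r ∈ I, r <:+ u r)
    (x : List ℕ →₀ E) :
    ∑ r ∈ I, D.NC (D.P (meet (u r)) x - D.P (meet r.tail) x) ≤ 2 * D.NC x := by
  classical
  let q : Seminorm ℝ (List ℕ →₀ E) :=
    ∑ r ∈ I, D.NC.comp (D.P (meet (u r)) - D.P (meet r.tail))
  have hq : ∀ y, q y = ∑ r ∈ I, D.NC (D.P (meet (u r)) y - D.P (meet r.tail) y) := by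
    intro y
    simp only [q, seminorm_sum_apply, Seminorm.comp_apply, LinearMap.sub_apply]
  rw [← hq]
  apply D.NC_bound q 2 (by norm_num)
  · intro t h
    rw [hq]
    by_cases hex : ∃ r ∈ I, r <:+ t
    · obtain ⟨r, hr, hrt⟩ := hex
      rw [Finset.sum_eq_single_of_mem r hr]
      · refine (map_sub_le_add D.NC _ _).trans ?_
        rw [P_single, P_single]
        have h1 := (D.NC_single_le (meet (u r) t) (D.ρ (meet (u r) t).length h)).trans
          (D.ρ_norm _ _)
        have h2 := (D.NC_single_le (meet r.tail t) (D.ρ (meet r.tail t).length h)).trans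
          (D.ρ_norm _ _)
        linarith
      · intro s hs hsr
        have : ¬ s <:+ t := fun hst => hI s hs r hr hsr (comp_of_suffix hst hrt)
        rw [P_single, P_single, meet_eq_tail (hu s hs) this, sub_self, map_zero]
    · push Not at hex
      rw [Finset.sum_eq_zero]
      · positivity
      · intro s hs
        rw [P_single, P_single, meet_eq_tail (hu s hs) (hex s hs), sub_self, map_zero]
  · intro a l f hf
    rw [hq]
    apply Finset.sum_eq_zero
    intro r _
    exact D.NC_R (D.R.sub_mem (D.P_R (adm_meet _) (D.gen_mem hf))
      (D.P_R (adm_meet _) (D.gen_mem hf)))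

/-- the sum map -/
noncomputable def Sm : (List ℕ →₀ E) →ₗ[ℝ] E := Finsupp.lsum ℝ fun _ => LinearMap.id

@[simp] lemma Sm_single (t : List ℕ) (h : E) : Sm (Finsupp.single t h) = h := by simp [Sm]

lemma Sm_le (x : List ℕ →₀ E) : ‖Sm x‖ ≤ D.NC x := by
  have := D.NC_bound ((normSeminorm ℝ E).comp Sm) 1 zero_le_one (by intro t h; simp)
    (by intro a l f _; simp) x
  simpa using this

lemma NC_single (t : List ℕ) (h : E) : D.NC (Finsupp.single t h) = ‖h‖ :=
  le_antisymm (D.NC_single_le t h) (by simpa using D.Sm_le (Finsupp.single t h))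

lemma R_coord {r : List ℕ →₀ E} (hr : r ∈ D.R) (hF : ∀ a l, D.F l ≤ D.F (a :: l)) (w : List ℕ) :
    r w ∈ D.F w := by
  classical
  induction hr using Submodule.span_induction with
  | mem x hx =>
    obtain ⟨a, l, f, hf, rfl⟩ := hx
    rw [Finsupp.sub_apply, Finsupp.single_apply, Finsupp.single_apply]
    refine Submodule.sub_mem _ ?_ ?_
    · split_ifs with h
      · subst h; exact hF a l hf
      · exact Submodule.zero_mem _
    · split_ifs with h
      · subst h; exact hf
      · exact Submodule.zero_mem _
  | zero => exact Submodule.zero_mem _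
  | add x y _ _ hx hy => exact Submodule.add_mem _ hx hy
  | smul c x _ hx => exact Submodule.smul_mem _ _ hx

end TD
end tree
end NCX

open Filter Topology

namespace NCX

section interp
variable {M : Type*} [AddCommGroup M] [Module ℝ M] (N1 N0 : Seminorm ℝ M)

/-- the interpolation seminorms -/
noncomputable def jj (n : ℕ) : Seminorm ℝ M :=
  (((1 / 2 : NNReal) ^ n) • N1) ⊓ (((2 : NNReal) ^ n) • N0)

lemma jj_apply (n : ℕ) (x : M) :
    jj N1 N0 n x = ⨅ u, ((1 / 2 : ℝ) ^ n * N1 u + 2 ^ n * N0 (x - u)) := by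
  rw [jj, Seminorm.inf_apply]
  simp [NNReal.smul_def, smul_apply]

lemma jj_bdd (n : ℕ) (x : M) :
    BddBelow (Set.range fun u => ((1 / 2 : ℝ) ^ n * N1 u + 2 ^ n * N0 (x - u))) :=
  ⟨0, by rintro _ ⟨u, rfl⟩; positivity⟩

lemma jj_le (n : ℕ) (x a : M) : jj N1 N0 n x ≤ (1 / 2 : ℝ) ^ n * N1 a + 2 ^ n * N0 (x - a) := by
  rw [jj_apply]; exact ciInf_le (jj_bdd N1 N0 n x) a

lemma jj_lt (n : ℕ) (x : M) (b : ℝ) (h : jj N1 N0 n x < b) :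
    ∃ a, (1 / 2 : ℝ) ^ n * N1 a + 2 ^ n * N0 (x - a) < b := by
  rw [jj_apply] at h; exact exists_lt_of_ciInf_lt h

lemma jj_le1 (n : ℕ) (x : M) : jj N1 N0 n x ≤ (1 / 2 : ℝ) ^ n * N1 x := by
  simpa using jj_le N1 N0 n x x

lemma jj_le0 (n : ℕ) (x : M) : jj N1 N0 n x ≤ 2 ^ n * N0 x := by
  simpa using jj_le N1 N0 n x 0

lemma jj_zero_ge (h01 : ∀ x, N0 x ≤ N1 x) (x : M) : N0 x ≤ jj N1 N0 0 x := by
  rw [jj_apply]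
  refine le_ciInf fun u => ?_
  have := map_add_le_add N0 u (x - u)
  rw [add_sub_cancel] at this
  simp only [pow_zero, one_mul]
  linarith [h01 u]

lemma jj_sum_le (m : ℕ) (x : M) : ∑ n ∈ Finset.range m, jj N1 N0 n x ≤ 2 * N1 x := by
  calc ∑ n ∈ Finset.range m, jj N1 N0 n x ≤ ∑ n ∈ Finset.range m, (1 / 2 : ℝ) ^ n * N1 x :=
        Finset.sum_le_sum fun n _ => jj_le1 _ _ n x
    _ = (∑ n ∈ Finset.range m, (1 / 2 : ℝ) ^ n) * N1 x := by rw [Finset.sum_mul]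
    _ ≤ 2 * N1 x := by
        gcongr
        exact sum_geometric_two_le m

/-- the interpolated seminorm -/
noncomputable def NVV : Seminorm ℝ M := ⨆ m : ℕ, ∑ n ∈ Finset.range m, jj N1 N0 n

lemma NVV_bdd : BddAbove (Set.range fun m : ℕ => ∑ n ∈ Finset.range m, jj N1 N0 n) := by
  refine ⟨(2 : NNReal) • N1, ?_⟩
  rintro _ ⟨m, rfl⟩
  intro x
  simp only [seminorm_sum_apply, smul_apply, NNReal.smul_def]
  exact jj_sum_le N1 N0 m x

lemma NVV_apply (x : M) : NVV N1 N0 x = ⨆ m : ℕ, ∑ n ∈ Finset.range m, jj N1 N0 n x := by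
  rw [NVV, Seminorm.iSup_apply (NVV_bdd N1 N0)]
  simp only [seminorm_sum_apply]

lemma NVV_bdd' (x : M) : BddAbove (Set.range fun m : ℕ => ∑ n ∈ Finset.range m, jj N1 N0 n x) :=
  ⟨2 * N1 x, by rintro _ ⟨m, rfl⟩; exact jj_sum_le N1 N0 m x⟩

lemma le_NVV (m : ℕ) (x : M) : ∑ n ∈ Finset.range m, jj N1 N0 n x ≤ NVV N1 N0 x := by
  rw [NVV_apply]; exact le_ciSup (NVV_bdd' N1 N0 x) m

lemma jj_le_NVV (m : ℕ) (x : M) : jj N1 N0 m x ≤ NVV N1 N0 x :=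
  le_trans (Finset.single_le_sum (f := fun n => jj N1 N0 n x) (fun _ _ => apply_nonneg _ _)
    (Finset.self_mem_range_succ m)) (le_NVV N1 N0 (m + 1) x)

lemma NVV_le (x : M) : NVV N1 N0 x ≤ 2 * N1 x := by
  rw [NVV_apply]; exact ciSup_le fun m => jj_sum_le N1 N0 m x

lemma NVV_lt (x : M) (b : ℝ) (h : b < NVV N1 N0 x) :
    ∃ m : ℕ, b < ∑ n ∈ Finset.range m, jj N1 N0 n x := by
  rw [NVV_apply] at h; exact exists_lt_of_lt_ciSup h

lemma N0_le_NVV (h01 : ∀ x, N0 x ≤ N1 x) (x : M) : N0 x ≤ NVV N1 N0 x :=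
  (jj_zero_ge N1 N0 h01 x).trans (jj_le_NVV N1 N0 0 x)

end interp

namespace TD
variable {E : Type} [NormedAddCommGroup E] [NormedSpace ℝ E] (D : TD E)

/-- sup over segments -/
noncomputable def NZ : Seminorm ℝ (List ℕ →₀ E) := ⨆ u, D.NC.comp (D.P (meet u))

lemma NZ_bdd : BddAbove (Set.range fun u => D.NC.comp (D.P (meet u))) :=
  ⟨D.NC, by rintro _ ⟨u, rfl⟩; intro x; exact D.P_NC (adm_meet u) x⟩

lemma NZ_apply (x : List ℕ →₀ E) : D.NZ x = ⨆ u, D.NC (D.P (meet u) x) := by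
  rw [NZ, Seminorm.iSup_apply D.NZ_bdd]; rfl

lemma NZ_bdd' (x : List ℕ →₀ E) : BddAbove (Set.range fun u => D.NC (D.P (meet u) x)) :=
  ⟨D.NC x, by rintro _ ⟨u, rfl⟩; exact D.P_NC (adm_meet u) x⟩

lemma le_NZ (u : List ℕ) (x : List ℕ →₀ E) : D.NC (D.P (meet u) x) ≤ D.NZ x := by
  rw [NZ_apply]; exact le_ciSup (D.NZ_bdd' x) u

lemma NZ_le (x : List ℕ →₀ E) : D.NZ x ≤ D.NC x := by
  rw [NZ_apply]; exact ciSup_le fun u => D.P_NC (adm_meet u) x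

lemma NZ_lt (x : List ℕ →₀ E) (b : ℝ) (h : b < D.NZ x) : ∃ u, b < D.NC (D.P (meet u) x) := by
  rw [NZ_apply] at h; exact exists_lt_of_lt_ciSup h

/-- the norm of the universal space -/
noncomputable def NV : Seminorm ℝ (List ℕ →₀ E) := NVV D.NC D.NZ

lemma NZ_le_NV (x : List ℕ →₀ E) : D.NZ x ≤ D.NV x := N0_le_NVV _ _ D.NZ_le x

lemma NV_le (x : List ℕ →₀ E) : D.NV x ≤ 2 * L1 x :=
  (NVV_le _ _ x).trans (by linarith [D.NC_le_L1 x])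

lemma dense_of_le [TopologicalSpace.SeparableSpace E] (q : Seminorm ℝ (List ℕ →₀ E))
    (hq : ∀ x, q x ≤ 2 * L1 x) : ∃ d : ℕ → (List ℕ →₀ E), ∀ x, ∀ ε > 0, ∃ i, q (x - d i) < ε := by
  obtain ⟨d, hd⟩ := L1_dense (E := E)
  refine ⟨d, fun x ε hε => ?_⟩
  obtain ⟨i, hi⟩ := hd x (ε / 2) (by positivity)
  exact ⟨i, by linarith [hq (x - d i)]⟩

lemma P_fg (u : List ℕ) : (LinearMap.range (D.P (meet u))).FG := by
  classical
  have h := Submodule.fg_biSup (u.tails.toFinset)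
    (fun s => (LinearMap.range (D.ρ s.length)).map (Finsupp.lsingle (R := ℝ) (M := E) s))
    (fun s _ => (D.ρ_fg _).map _)
  refine h.of_le ?_
  rintro _ ⟨x, rfl⟩
  induction x using Finsupp.induction_linear with
  | zero => rw [map_zero]; exact Submodule.zero_mem _
  | add x y hx hy => rw [map_add]; exact Submodule.add_mem _ hx hy
  | single t f =>
    rw [P_single]
    refine Submodule.mem_iSup_of_mem (meet u t) (Submodule.mem_iSup_of_mem ?_ ?_)
    · simpa using meet_suffix_left u t
    · exact ⟨_, ⟨f, rfl⟩, rfl⟩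

section V
variable [TopologicalSpace.SeparableSpace E]
variable {V : Type*} [NormedAddCommGroup V] [NormedSpace ℝ V]
  (Φ : (List ℕ →₀ E) →ₗ[ℝ] V)

lemma exists_p (hΦ : ∀ x, ‖Φ x‖ = D.NV x) (hd : DenseRange Φ) :
    ∃ Ψ : (List ℕ →₀ E) →ₗ[ℝ] CantorC, (∀ x, ‖Ψ x‖ = D.NC x) ∧
    ∃ p : List ℕ → V →L[ℝ] CantorC, (∀ u w, p u (Φ w) = Ψ (D.P (meet u) w)) ∧
      (∀ u v, ‖p u v‖ ≤ ‖v‖) ∧ ∀ u, (LinearMap.range (p u : V →ₗ[ℝ] CantorC)).FG := by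
  obtain ⟨d, hd'⟩ := dense_of_le D.NC (fun x => by
    have := D.NC_le_L1 x
    have := apply_nonneg (L1 (E := E)) x
    linarith)
  obtain ⟨Ψ, hΨ⟩ := BM D.NC d hd'
  refine ⟨Ψ, hΨ, ?_⟩
  have := fun u => ext_exists Φ hd (Ψ ∘ₗ D.P (meet u)) 1 (fun w => by
    rw [one_mul, hΦ, LinearMap.comp_apply, hΨ]
    exact (D.le_NZ u w).trans (D.NZ_le_NV w))
  choose p hp1 hp2 hp3 using this
  refine ⟨p, hp1, fun u v => by simpa using hp2 u v, fun u => hp3 u ?_⟩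
  rw [LinearMap.range_comp]
  exact (D.P_fg u).map _

lemma approx (hΦ : ∀ x, ‖Φ x‖ = D.NV x) (hd : DenseRange Φ)
    (v : V) {ε : ℝ} (hε : 0 < ε) : ∃ w, ‖v - Φ w‖ < ε := by
  obtain ⟨w, hw⟩ := hd.exists_dist_lt v hε
  exact ⟨w, by rwa [← dist_eq_norm]⟩

lemma exists_T (hΦ : ∀ x, ‖Φ x‖ = D.NV x) (hd : DenseRange Φ) :
    ∃ T : ℕ → V →L[ℝ] CantorC, (∀ n w, ‖T n (Φ w)‖ = jj D.NC D.NZ n w) ∧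
    (∀ m v, ∑ n ∈ Finset.range m, ‖T n v‖ ≤ ‖v‖) ∧
    ∀ v, ∃ m, (1 / 4 : ℝ) * ‖v‖ ≤ ∑ n ∈ Finset.range m, ‖T n v‖ := by
  have h1 : ∀ n, ∃ T : V →L[ℝ] CantorC, ∀ w, ‖T (Φ w)‖ = jj D.NC D.NZ n w := by
    intro n
    obtain ⟨d, hd'⟩ := dense_of_le (jj D.NC D.NZ n) (fun x =>
      (jj_le_NVV _ _ n x).trans (D.NV_le x))
    obtain ⟨Θ, hΘ⟩ := BM _ d hd'
    obtain ⟨T, hT, -⟩ := ext_exists Φ hd Θ 1 (fun w => by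
      rw [one_mul, hΦ, hΘ]; exact jj_le_NVV _ _ n w)
    exact ⟨T, fun w => by rw [hT, hΘ]⟩
  choose T hT using h1
  have h2 : ∀ m v, ∑ n ∈ Finset.range m, ‖T n v‖ ≤ ‖v‖ := by
    intro m v
    refine hd.induction_on (p := fun v => ∑ n ∈ Finset.range m, ‖T n v‖ ≤ ‖v‖) v ?_ ?_
    · exact isClosed_le (by fun_prop) (by fun_prop)
    · intro w
      simp only [hT, hΦ]
      exact le_NVV _ _ m w
  refine ⟨T, hT, h2, fun v => ?_⟩
  by_cases hv : v = 0
  · exact ⟨0, by simp [hv]⟩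
  have hv' : 0 < ‖v‖ := norm_pos_iff.2 hv
  obtain ⟨w, hw⟩ := D.approx Φ hΦ hd v (ε := ‖v‖ / 4) (by positivity)
  have h3 : ‖v‖ - ‖v‖ / 4 < D.NV w := by
    rw [← hΦ]
    have := norm_add_le (v - Φ w) (Φ w)
    rw [sub_add_cancel] at this
    linarith
  obtain ⟨m, hm⟩ := NVV_lt _ _ w _ h3
  refine ⟨m, ?_⟩
  have h4 : ∑ n ∈ Finset.range m, jj D.NC D.NZ n w ≤
      ∑ n ∈ Finset.range m, ‖T n v‖ + ∑ n ∈ Finset.range m, ‖T n (v - Φ w)‖ := by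
    rw [← Finset.sum_add_distrib]
    refine Finset.sum_le_sum fun n _ => ?_
    rw [← hT]
    have := norm_sub_le (T n v) (T n (v - Φ w))
    rw [← map_sub] at this
    simpa using this
  have h5 := h2 m (v - Φ w)
  linarith

/-- the core dichotomy transported to the universal space -/
lemma coreV (hΦ : ∀ x, ‖Φ x‖ = D.NV x) (hd : DenseRange Φ)
    {X : Type*} [NormedAddCommGroup X] [NormedSpace ℝ X] [CompleteSpace X]
    (hX : ¬ Embeds EllOne X) (hinf : InfD (⊤ : Submodule ℝ X))
    (S : X →L[ℝ] V) (c : ℝ) (hc : 0 < c) (hS : ∀ x, c * ‖x‖ ≤ ‖S x‖)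
    (Ψ : (List ℕ →₀ E) →ₗ[ℝ] CantorC) (hΨ : ∀ x, ‖Ψ x‖ = D.NC x)
    (p : List ℕ → V →L[ℝ] CantorC) (hp : ∀ u w, p u (Φ w) = Ψ (D.P (meet u) w))
    (hp1 : ∀ u v, ‖p u v‖ ≤ ‖v‖) (hfr : ∀ u, (LinearMap.range (p u : V →ₗ[ℝ] CantorC)).FG) :
    ∃ σ, ∃ S' : Submodule ℝ X, InfD S' ∧ ∃ δ > 0, ∀ x ∈ S', ‖x‖ = 1 →
      ∃ n, δ < ‖p (br σ n) (S x)‖ := by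
  have key : ∀ u r (v : V) w, ‖p u v - p r v‖ ≤
      D.NC (D.P (meet u) w - D.P (meet r) w) + 2 * ‖v - Φ w‖ := by
    intro u r v w
    rw [← hΨ, map_sub, ← hp, ← hp]
    have e : p u v - p r v = (p u (Φ w) - p r (Φ w)) + (p u (v - Φ w) - p r (v - Φ w)) := by
      simp only [map_sub]; abel
    rw [e]
    refine (norm_add_le _ _).trans ?_
    have := norm_sub_le (p u (v - Φ w)) (p r (v - Φ w))
    have := hp1 u (v - Φ w)
    have := hp1 r (v - Φ w)
    linarith
  have hcx : ∃ c > 0, ∀ x, ∃ u, c * ‖x‖ ≤ ‖p u (S x)‖ := by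
    obtain ⟨T, hT, hT1, hT2⟩ := D.exists_T Φ hΦ hd
    obtain ⟨N, c', hc', h1⟩ := A2 hX (fun n => (T n).comp S) ‖S‖ (fun m x =>
      (hT1 m (S x)).trans (S.le_opNorm x)) (c / 4) (by positivity) (fun x => by
        obtain ⟨m, hm⟩ := hT2 (S x)
        refine ⟨m, le_trans ?_ hm⟩
        linarith [hS x])
    have h2N : (0 : ℝ) < 2 ^ N := by positivity
    refine ⟨c' / (4 * 2 ^ N), by positivity, fun x => ?_⟩
    by_cases hx : x = 0
    · exact ⟨[], by simp [hx]⟩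
    have hx' : 0 < ‖x‖ := norm_pos_iff.2 hx
    set η : ℝ := c' * ‖x‖ / 2 ^ N / 8 with hη
    have hη0 : 0 < η := by positivity
    have hη1 : c' * ‖x‖ = 2 ^ N * (8 * η) := by rw [hη]; field_simp
    obtain ⟨w, hw⟩ := D.approx Φ hΦ hd (S x) hη0
    have h2 : c' * ‖x‖ ≤ 2 ^ N * D.NZ w + η := by
      refine (h1 x).trans ?_
      have h3 : ∑ n ∈ Finset.range N, ‖T n (S x)‖ ≤
          ∑ n ∈ Finset.range N, ‖T n (Φ w)‖ + ∑ n ∈ Finset.range N, ‖T n (S x - Φ w)‖ := by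
        rw [← Finset.sum_add_distrib]
        refine Finset.sum_le_sum fun n _ => ?_
        have := norm_add_le (T n (Φ w)) (T n (S x - Φ w))
        rw [← map_add] at this
        simpa using this
      have h4 := hT1 N (S x - Φ w)
      have h5 : ∑ n ∈ Finset.range N, ‖T n (Φ w)‖ ≤ 2 ^ N * D.NZ w := by
        calc ∑ n ∈ Finset.range N, ‖T n (Φ w)‖ ≤ ∑ n ∈ Finset.range N, 2 ^ n * D.NZ w :=
              Finset.sum_le_sum fun n _ => by rw [hT]; exact jj_le0 _ _ n w
          _ = (∑ n ∈ Finset.range N, (2 : ℝ) ^ n) * D.NZ w := by rw [Finset.sum_mul]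
          _ ≤ 2 ^ N * D.NZ w := by
            gcongr
            rw [geom_sum_eq (by norm_num)]
            norm_num
      show ∑ n ∈ Finset.range N, ‖T n (S x)‖ ≤ _
      linarith
    have h3 : 7 * η ≤ D.NZ w := by
      by_contra hcon
      push Not at hcon
      have h4 : 2 ^ N * D.NZ w < 2 ^ N * (7 * η) := mul_lt_mul_of_pos_left hcon h2N
      have h5 : η ≤ 2 ^ N * η := le_mul_of_one_le_left hη0.le (one_le_pow₀ (by norm_num))
      nlinarith
    obtain ⟨u, hu⟩ := D.NZ_lt w (6 * η) (by linarith)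
    refine ⟨u, ?_⟩
    rw [← hΨ, ← hp] at hu
    have h4 := hp1 u (S x - Φ w)
    have h5 : ‖p u (Φ w)‖ ≤ ‖p u (S x)‖ + ‖p u (S x - Φ w)‖ := by
      have := norm_sub_le (p u (S x)) (p u (S x - Φ w))
      rw [← map_sub] at this
      simpa using this
    have h6 : c' / (4 * 2 ^ N) * ‖x‖ = 2 * η := by rw [hη]; field_simp; norm_num
    rw [h6]
    linarith
  obtain ⟨c₁, hc₁, hcx⟩ := hcx
  have hfr' : ∀ u, (LinearMap.range ((p u).comp S : X →ₗ[ℝ] CantorC)).FG := by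
    intro u
    refine (hfr u).of_le ?_
    rintro _ ⟨x, rfl⟩
    exact ⟨S x, rfl⟩
  suffices hmain : ∃ σ, ∃ S' ≤ (⊤ : Submodule ℝ X), InfD S' ∧ ∃ δ > 0, ∀ x ∈ S', ‖x‖ = 1 →
      ∃ n, δ < ‖((p (br σ n)).comp S) x‖ by
    obtain ⟨σ, S', -, hS', δ, hδ, h⟩ := hmain
    exact ⟨σ, S', hS', δ, hδ, h⟩
  refine core (fun u => (p u).comp S) hinf hfr' ‖S‖ ?_ ?_ ?_ ?_ c₁ hc₁ hcx
  · intro u x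
    exact (hp1 u _).trans (S.le_opNorm x)
  · intro u v x huv
    refine hd.induction_on (p := fun y => ‖p v y‖ ≤ ‖p u y‖) (S x) ?_ ?_
    · exact isClosed_le (by fun_prop) (by fun_prop)
    · intro w
      simp only [hp, hΨ]
      exact D.P_mono huv w
  · intro x ε hε
    obtain ⟨w, hw⟩ := D.approx Φ hΦ hd (S x) (ε := ε / 2) (by positivity)
    have hfin : (⋃ t ∈ w.support, {s | s ∈ t.tails}).Finite :=
      Set.Finite.biUnion w.support.finite_toSet fun t _ => List.finite_toSet _
    refine hfin.subset ?_
    rintro t ⟨r, u, htr, hru, hlt⟩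
    by_contra hcon
    simp only [Set.mem_iUnion, Set.mem_setOf_eq, List.mem_tails, not_exists] at hcon
    have h1 := D.P_diff hru w (fun s hs hrs => hcon s hs (htr.trans hrs))
    have h2 := key u r.tail (S x) w
    rw [h1, sub_self, map_zero] at h2
    simp only [ContinuousLinearMap.comp_apply] at hlt
    linarith
  · intro ε hε C
    set C' : ℝ := ‖S‖ * |C| + 1 with hC'
    have hC'0 : 0 < C' := by positivity
    obtain ⟨n, hn⟩ := exists_pow_lt_of_lt_one (show 0 < ε / (16 * C') by positivity)
      (show (1 / 2 : ℝ) < 1 by norm_num)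
    refine ⟨⌈(2 * (2 ^ n * (2 * C'))) / (ε / 2)⌉₊, fun x hx I hI hIu => ?_⟩
    obtain ⟨w, hw⟩ := D.approx Φ hΦ hd (S x) (ε := min 1 (ε / 8)) (by positivity)
    have hw1 := hw.trans_le (min_le_left _ _)
    have hw2 := hw.trans_le (min_le_right _ _)
    have hj : jj D.NC D.NZ n w < 2 * C' := by
      have h1 := jj_le_NVV D.NC D.NZ n w
      have h2 : 1 ≤ C' := by rw [hC']; linarith [mul_nonneg (norm_nonneg S) (abs_nonneg C)]
      have h3 : NVV D.NC D.NZ w ≤ C' := by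
        show D.NV w ≤ C'
        rw [← hΦ]
        have h1 := norm_sub_le (S x) (S x - Φ w)
        rw [sub_sub_cancel] at h1
        have h2 : ‖S x‖ ≤ ‖S‖ * |C| := (S.le_opNorm x).trans
          (mul_le_mul_of_nonneg_left (hx.trans (le_abs_self C)) (norm_nonneg _))
        linarith
      linarith
    obtain ⟨a, ha⟩ := jj_lt _ _ _ _ _ hj
    have ha1 : D.NC a ≤ 2 ^ n * (2 * C') := by
      have h0 : (1 / 2 : ℝ) ^ n * D.NC a ≤ 2 * C' := by
        have : 0 ≤ 2 ^ n * D.NZ (w - a) := by positivity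
        linarith
      have h1 : (2 : ℝ) ^ n * (1 / 2) ^ n = 1 := by rw [← mul_pow]; norm_num
      calc D.NC a = 2 ^ n * ((1 / 2) ^ n * D.NC a) := by rw [← mul_assoc, h1, one_mul]
        _ ≤ _ := by gcongr
    have ha2 : D.NZ (w - a) ≤ (1 / 2) ^ n * (2 * C') := by
      have h0 : 2 ^ n * D.NZ (w - a) ≤ 2 * C' := by
        have : 0 ≤ (1 / 2 : ℝ) ^ n * D.NC a := by positivity
        linarith
      have h1 : (1 / 2) ^ n * (2 : ℝ) ^ n = 1 := by rw [← mul_pow]; norm_num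
      calc D.NZ (w - a) = (1 / 2) ^ n * (2 ^ n * D.NZ (w - a)) := by rw [← mul_assoc, h1, one_mul]
        _ ≤ _ := by gcongr
    have ha3 : D.NZ (w - a) ≤ ε / 8 := by
      rw [lt_div_iff₀ (by positivity)] at hn
      linarith
    have hIu' : ∀ r, ∃ u, r ∈ I → (r <:+ u ∧ ε < ‖p u (S x) - p r.tail (S x)‖) := by
      intro r
      by_cases hr : r ∈ I
      · obtain ⟨u, hu⟩ := hIu r hr
        exact ⟨u, fun _ => hu⟩
      · exact ⟨[], fun h => absurd h hr⟩
    choose u hu using hIu'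
    have h1 := D.P_count I hI u (fun r hr => (hu r hr).1) a
    have h2 : ∀ r ∈ I, ε / 2 ≤ D.NC (D.P (meet (u r)) a - D.P (meet r.tail) a) := by
      intro r hr
      have h3 := (hu r hr).2
      have h4 := key (u r) r.tail (S x) w
      have e : D.P (meet (u r)) w - D.P (meet r.tail) w =
          (D.P (meet (u r)) a - D.P (meet r.tail) a) +
            (D.P (meet (u r)) (w - a) - D.P (meet r.tail) (w - a)) := by
        simp only [map_sub]; abel
      rw [e] at h4
      have h5 := map_add_le_add D.NC (D.P (meet (u r)) a - D.P (meet r.tail) a)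
        (D.P (meet (u r)) (w - a) - D.P (meet r.tail) (w - a))
      have h6 := map_sub_le_add D.NC (D.P (meet (u r)) (w - a)) (D.P (meet r.tail) (w - a))
      have h7 := D.le_NZ (u r) (w - a)
      have h8 := D.le_NZ r.tail (w - a)
      linarith
    have h3 : (I.card : ℝ) * (ε / 2) ≤ 2 * (2 ^ n * (2 * C')) := by
      have := Finset.card_nsmul_le_sum I _ _ h2
      rw [nsmul_eq_mul] at this
      linarith
    have h4 : (I.card : ℝ) ≤ (2 * (2 ^ n * (2 * C'))) / (ε / 2) := by
      rwa [le_div_iff₀ (by positivity)]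
    exact_mod_cast h4.trans (Nat.le_ceil _)
end V
end TD
end NCX

open Filter Topology

namespace NCX

lemma ext_pair {W V G : Type*} [AddCommGroup W] [Module ℝ W] [NormedAddCommGroup V]
    [NormedSpace ℝ V] [NormedAddCommGroup G] [NormedSpace ℝ G] [CompleteSpace G]
    (e : W →ₗ[ℝ] V) (f : W →ₗ[ℝ] G) (c K : ℝ)
    (h1 : ∀ w, c * ‖e w‖ ≤ ‖f w‖) (h2 : ∀ w, ‖f w‖ ≤ K * ‖e w‖) :
    ∃ g : (LinearMap.range e).topologicalClosure →L[ℝ] G, ∀ z, c * ‖z‖ ≤ ‖g z‖ := by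
  let e' : W →ₗ[ℝ] (LinearMap.range e).topologicalClosure :=
    e.codRestrict _ fun w => (Submodule.le_topologicalClosure _) ⟨w, rfl⟩
  have he' : ∀ w, ‖e' w‖ = ‖e w‖ := fun w => rfl
  have hd : DenseRange e' := by
    intro z
    rw [closure_subtype]
    have hz : (z : V) ∈ closure (Set.range e) := by
      have := z.2
      rwa [← SetLike.mem_coe, Submodule.topologicalClosure_coe, LinearMap.coe_range] at this
    convert hz using 2
    ext v
    constructor
    · rintro ⟨_, ⟨w, rfl⟩, rfl⟩; exact ⟨w, rfl⟩
    · rintro ⟨w, rfl⟩; exact ⟨e' w, ⟨w, rfl⟩, rfl⟩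
  obtain ⟨g, hg, -⟩ := ext_exists e' hd f K (fun w => by rw [he']; exact h2 w)
  refine ⟨g, fun z => ?_⟩
  refine hd.induction_on (p := fun z => c * ‖z‖ ≤ ‖g z‖) z ?_ ?_
  · exact isClosed_le (by fun_prop) (by fun_prop)
  · intro w
    rw [hg, he']; exact h1 w

lemma embeds_trans {X Y Z : Type*} [NormedAddCommGroup X] [NormedSpace ℝ X]
    [NormedAddCommGroup Y] [NormedSpace ℝ Y] [NormedAddCommGroup Z] [NormedSpace ℝ Z]
    (h1 : Embeds X Y) (h2 : Embeds Y Z) : Embeds X Z := by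
  obtain ⟨T, c, hc, hT⟩ := h1
  obtain ⟨S, d, hd, hS⟩ := h2
  refine ⟨S.comp T, d * c, by positivity, fun x => ?_⟩
  calc d * c * ‖x‖ = d * (c * ‖x‖) := by ring
    _ ≤ d * ‖T x‖ := by gcongr; exact hT x
    _ ≤ _ := hS _

/-- minimality through sequences -/
lemma minimal_seq {X : Type*} [NormedAddCommGroup X] [NormedSpace ℝ X] (hmin : IsMinimal X)
    {Y : Type*} [NormedAddCommGroup Y] [NormedSpace ℝ Y] [CompleteSpace Y]
    (x : ℕ → X) (y : ℕ → Y) (hx : LinearIndependent ℝ x) (c K : ℝ) (hc : 0 < c)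
    (h1 : ∀ a, c * ‖Finsupp.linearCombination ℝ x a‖ ≤ ‖Finsupp.linearCombination ℝ y a‖)
    (h2 : ∀ a, ‖Finsupp.linearCombination ℝ y a‖ ≤ K * ‖Finsupp.linearCombination ℝ x a‖) :
    Embeds X Y := by
  obtain ⟨g, hg⟩ := ext_pair (Finsupp.linearCombination ℝ x) (Finsupp.linearCombination ℝ y)
    c K h1 h2
  refine embeds_trans (hmin.2 _ (Submodule.isClosed_topologicalClosure _) ?_) ⟨g, c, hc, hg⟩
  intro hfd
  apply infD_span hx
  rw [Submodule.fg_iff_finiteDimensional]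
  apply Submodule.finiteDimensional_of_le
    (S₂ := (LinearMap.range (Finsupp.linearCombination ℝ x)).topologicalClosure)
  rw [← Finsupp.range_linearCombination]
  exact Submodule.le_topologicalClosure _

namespace TD
variable {E : Type} [NormedAddCommGroup E] [NormedSpace ℝ E] (D : TD E)

lemma F_mono_br (σ : ℕ → ℕ) {m n : ℕ} (h : m ≤ n) : D.F (br σ m) ≤ D.F (br σ n) := by
  induction n, h using Nat.le_induction with
  | base => exact le_rfl
  | succ n _ ih => rw [br_succ]; exact ih.trans (D.F_mono _ _)

lemma single_br (σ : ℕ → ℕ) {m n : ℕ} (h : m ≤ n) {f : E} (hf : f ∈ D.F (br σ m)) :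
    Finsupp.single (br σ n) f - Finsupp.single (br σ m) f ∈ D.R := by
  induction n, h using Nat.le_induction with
  | base => rw [sub_self]; exact D.R.zero_mem
  | succ n hn ih =>
    have h1 : f ∈ D.F (br σ n) := D.F_mono_br σ hn hf
    have h2 := D.gen_mem (a := σ n) h1
    rw [br_succ]
    have := D.R.add_mem h2 ih
    simpa using this

/-- elements on the branch -/
def OnB (σ : ℕ → ℕ) : Submodule ℝ (List ℕ →₀ E) where
  carrier := {g | ∃ N, ∃ f ∈ D.F (br σ N), g - Finsupp.single (br σ N) f ∈ D.R}
  zero_mem' := ⟨0, 0, Submodule.zero_mem _, by simp⟩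
  add_mem' := by
    rintro g g' ⟨N, f, hf, hg⟩ ⟨N', f', hf', hg'⟩
    refine ⟨max N N', f + f', Submodule.add_mem _ (D.F_mono_br σ (le_max_left _ _) hf)
      (D.F_mono_br σ (le_max_right _ _) hf'), ?_⟩
    have h1 := D.single_br σ (le_max_left N N') hf
    have h2 := D.single_br σ (le_max_right N N') hf'
    have h3 := D.R.sub_mem (D.R.sub_mem (D.R.add_mem hg hg') h1) h2
    convert h3 using 1
    rw [Finsupp.single_add]; abel
  smul_mem' := by
    rintro c g ⟨N, f, hf, hg⟩
    refine ⟨N, c • f, Submodule.smul_mem _ _ hf, ?_⟩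
    have := D.R.smul_mem c hg
    rwa [smul_sub, Finsupp.smul_single] at this

lemma Sm_R {r : List ℕ →₀ E} (hr : r ∈ D.R) : Sm r = 0 := by
  have := D.Sm_le r
  rw [D.NC_R hr] at this
  exact norm_le_zero_iff.1 this

lemma seminorm_congr {M : Type*} [AddCommGroup M] [Module ℝ M] (q : Seminorm ℝ M) {x y : M}
    (h : q (x - y) = 0) : q x = q y := by
  have h1 := map_add_le_add q (x - y) y
  have h2 := map_sub_le_add q x (x - y)
  rw [sub_add_cancel] at h1
  rw [sub_sub_cancel] at h2
  linarith

lemma OnB_NC {σ : ℕ → ℕ} {g : List ℕ →₀ E} (hg : g ∈ D.OnB σ) : D.NC g = ‖Sm g‖ := by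
  obtain ⟨N, f, hf, h⟩ := hg
  have h1 := D.Sm_R h
  rw [map_sub, Sm_single, sub_eq_zero] at h1
  rw [seminorm_congr D.NC (D.NC_R h), D.NC_single, h1]

lemma OnB_NV {σ : ℕ → ℕ} {g : List ℕ →₀ E} (hg : g ∈ D.OnB σ) :
    ‖Sm g‖ ≤ D.NV g ∧ D.NV g ≤ 2 * ‖Sm g‖ := by
  refine ⟨?_, (NVV_le _ _ g).trans_eq (by rw [D.OnB_NC hg])⟩
  obtain ⟨N, f, hf, h⟩ := hg
  have h1 := D.Sm_R h
  rw [map_sub, Sm_single, sub_eq_zero] at h1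
  have h2 : D.NV (g - Finsupp.single (br σ N) f) = 0 :=
    le_antisymm ((NVV_le _ _ _).trans_eq (by rw [D.NC_R h, mul_zero])) (apply_nonneg _ _)
  rw [seminorm_congr D.NV h2, h1]
  refine le_trans ?_ ((D.le_NZ (br σ N) _).trans (D.NZ_le_NV _))
  rw [P_single, meet_eq_self List.suffix_rfl, D.F_fix _ _ hf, D.NC_single]

/-- the branch spaces embed -/
lemma embY {V : Type*} [NormedAddCommGroup V] [NormedSpace ℝ V] [CompleteSpace V]
    (Φ : (List ℕ →₀ E) →ₗ[ℝ] V) (hΦ : ∀ x, ‖Φ x‖ = D.NV x) (σ : ℕ → ℕ)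
    {Y : Type*} [NormedAddCommGroup Y] [NormedSpace ℝ Y] (ι : Y →ₗᵢ[ℝ] E)
    (hY : ∀ y, ι y ∈ closure (⋃ n, (D.F (br σ n) : Set E))) : Embeds Y V := by
  obtain ⟨g, hg⟩ := ext_pair (Sm.domRestrict (D.OnB σ)) (Φ.domRestrict (D.OnB σ)) 1 2
    (fun w => by
      rw [one_mul, LinearMap.domRestrict_apply, LinearMap.domRestrict_apply, hΦ]
      exact (D.OnB_NV w.2).1)
    (fun w => by
      rw [LinearMap.domRestrict_apply, LinearMap.domRestrict_apply, hΦ]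
      exact (D.OnB_NV w.2).2)
  have hmem : ∀ y, ι y ∈ (LinearMap.range (Sm.domRestrict (D.OnB σ))).topologicalClosure := by
    intro y
    rw [← SetLike.mem_coe, Submodule.topologicalClosure_coe]
    refine closure_mono ?_ (hY y)
    intro f hf
    obtain ⟨n, hn⟩ := Set.mem_iUnion.1 hf
    exact ⟨⟨Finsupp.single (br σ n) f, n, f, hn, by simp⟩, by simp⟩
  refine ⟨g.comp (ι.toContinuousLinearMap.codRestrict _ hmem), 1, one_pos, fun y => ?_⟩
  refine le_trans ?_ (hg _)
  rw [one_mul, one_mul]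
  exact (ι.norm_map y).ge

end TD
end NCX

open Filter Topology

namespace NCX
namespace TD
variable {E : Type} [NormedAddCommGroup E] [NormedSpace ℝ E] (D : TD E)

lemma Psig_le_NV (σ : ℕ → ℕ) (w : List ℕ →₀ E) : D.NC (D.P (msig σ) w) ≤ D.NV w := by
  obtain ⟨m, hm⟩ := D.P_br σ w
  rw [← hm m le_rfl]
  exact (D.le_NZ _ w).trans (D.NZ_le_NV w)

lemma P_br_le (σ : ℕ → ℕ) (n : ℕ) (w : List ℕ →₀ E) :
    D.NC (D.P (meet (br σ n)) w) ≤ D.NC (D.P (msig σ) w) := by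
  obtain ⟨m, hm⟩ := D.P_br σ w
  rw [← hm (max m n) (le_max_left _ _)]
  exact D.P_mono (br_suffix σ (le_max_right _ _)) w

lemma br_inj (σ : ℕ → ℕ) {m n : ℕ} (h : br σ m = br σ n) : m = n := by
  have := congrArg List.length h
  simpa using this

/-- the quotient seminorm -/
noncomputable def qF (t : List ℕ) : Seminorm ℝ E :=
  (normSeminorm ℝ (E ⧸ D.F t)).comp (D.F t).mkQ

lemma qF_le (t : List ℕ) (e : E) : D.qF t e ≤ ‖e‖ := Submodule.Quotient.norm_mk_le _ _

lemma qF_zero {t : List ℕ} {e : E} (he : e ∈ D.F t) : D.qF t e = 0 := by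
  show ‖(D.F t).mkQ e‖ = 0
  rw [(Submodule.Quotient.mk_eq_zero _).2 he |> (show (D.F t).mkQ e = 0 from ·), norm_zero]

lemma qF_exists (t : List ℕ) (e : E) {ε : ℝ} (hε : 0 < ε) :
    ∃ f ∈ D.F t, ‖e - f‖ < D.qF t e + ε := by
  obtain ⟨s, hs, hs'⟩ := QuotientAddGroup.exists_norm_mk_lt ((D.F t).mkQ e) hε
  refine ⟨e - s, ?_, by rw [sub_sub_cancel]; exact hs'⟩
  have : (D.F t).mkQ s = (D.F t).mkQ e := hs
  rw [← Submodule.Quotient.mk_eq_zero]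
  show (D.F t).mkQ (e - s) = 0
  rw [map_sub, this, sub_self]

lemma qF_sum (σ : ℕ → ℕ) (m : ℕ) (z : List ℕ →₀ E) :
    ∑ n ∈ Finset.range m, D.qF (br σ n) (z (br σ n)) ≤ D.NC z := by
  classical
  let q : Seminorm ℝ (List ℕ →₀ E) :=
    ∑ n ∈ Finset.range m, (D.qF (br σ n)).comp (Finsupp.lapply (br σ n))
  have hq : ∀ y, q y = ∑ n ∈ Finset.range m, D.qF (br σ n) (y (br σ n)) := by
    intro y
    simp only [q, seminorm_sum_apply, Seminorm.comp_apply, Finsupp.lapply_apply]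
  have := D.NC_bound q 1 zero_le_one (by
    intro t h
    rw [hq, one_mul]
    by_cases hex : ∃ n ∈ Finset.range m, br σ n = t
    · obtain ⟨n, hn, rfl⟩ := hex
      rw [Finset.sum_eq_single_of_mem n hn]
      · rw [Finsupp.single_eq_same]; exact D.qF_le _ _
      · intro k _ hk
        rw [Finsupp.single_eq_of_ne (fun h => hk (br_inj σ h)), map_zero]
    · push Not at hex
      rw [Finset.sum_eq_zero]
      · exact norm_nonneg _
      · intro n hn
        rw [Finsupp.single_eq_of_ne (hex n hn), map_zero]) (by
    intro a l f hf
    rw [hq]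
    exact Finset.sum_eq_zero fun n _ =>
      D.qF_zero (D.R_coord (D.gen_mem hf) D.F_mono _)) z
  rwa [one_mul, hq] at this

/-- the image of the branch projection lives on the branch -/
lemma Psig_decomp (σ : ℕ → ℕ) (w : List ℕ →₀ E) : ∃ N, D.P (msig σ) w =
    ∑ n ∈ Finset.range N, Finsupp.single (br σ n) (D.P (msig σ) w (br σ n)) := by
  classical
  have h : ∃ N, ∀ t ∈ (D.P (msig σ) w).support, ∃ n < N, t = br σ n := by
    induction w using Finsupp.induction_linear with
    | zero => exact ⟨0, by simp⟩
    | add x y hx hy =>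
      obtain ⟨N, hN⟩ := hx
      obtain ⟨N', hN'⟩ := hy
      refine ⟨max N N', fun t ht => ?_⟩
      rw [map_add] at ht
      rcases Finset.mem_union.1 (Finsupp.support_add ht) with h | h
      · obtain ⟨n, hn, e⟩ := hN t h; exact ⟨n, lt_max_of_lt_left hn, e⟩
      · obtain ⟨n, hn, e⟩ := hN' t h; exact ⟨n, lt_max_of_lt_right hn, e⟩
    | single t f =>
      refine ⟨(msig σ t).length + 1, fun s hs => ?_⟩
      rw [P_single] at hs
      have h1 := Finsupp.support_single_subset hs
      rw [Finset.mem_singleton] at h1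
      refine ⟨(msig σ t).length, Nat.lt_succ_self _, ?_⟩
      rw [h1]
      have h2 := meet_suffix_left (br σ t.length) t
      rw [meet_br σ t _ le_rfl] at h2
      exact suffix_br h2
  obtain ⟨N, hN⟩ := h
  refine ⟨N, ?_⟩
  ext t
  rw [Finsupp.finsetSum_apply]
  by_cases ht : ∃ n ∈ Finset.range N, br σ n = t
  · obtain ⟨n, hn, rfl⟩ := ht
    rw [Finset.sum_eq_single_of_mem n hn]
    · rw [Finsupp.single_eq_same]
    · intro k _ hk
      rw [Finsupp.single_eq_of_ne (fun h => hk (br_inj σ h.symm))]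
  · push Not at ht
    rw [Finset.sum_eq_zero fun n hn => Finsupp.single_eq_of_ne (ht n hn).symm]
    by_contra hcon
    obtain ⟨n, hn, e⟩ := hN t (Finsupp.mem_support_iff.2 hcon)
    exact ht n (Finset.mem_range.2 hn) e.symm

lemma coord_fg (σ : ℕ → ℕ) (n : ℕ) :
    (LinearMap.range (Finsupp.lapply (R := ℝ) (br σ n) ∘ₗ D.P (msig σ))).FG := by
  classical
  refine (D.ρ_fg n).of_le ?_
  rintro _ ⟨w, rfl⟩
  induction w using Finsupp.induction_linear with
  | zero => rw [map_zero]; exact Submodule.zero_mem _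
  | add x y hx hy => rw [map_add]; exact Submodule.add_mem _ hx hy
  | single t f =>
    rw [LinearMap.comp_apply, P_single, Finsupp.lapply_apply, Finsupp.single_apply]
    split_ifs with h
    · rw [h, br_length]; exact ⟨f, rfl⟩
    · exact Submodule.zero_mem _

/-- approximating by an element of the branch -/
lemma approx_branch (σ : ℕ → ℕ) (L : E →ₗ[ℝ] EllOne) (hL : ∀ e, ‖L e‖ ≤ ‖e‖)
    (w : List ℕ →₀ E) (η : ℝ) (hη : 0 < η)
    (h1 : ∀ m, ∑ n ∈ Finset.range m, D.qF (br σ n) (D.P (msig σ) w (br σ n)) ≤ 3 * η)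
    (h2 : ‖L (Sm (D.P (msig σ) w))‖ ≤ 3 * η) :
    ∃ N, ∃ f ∈ D.F (br σ N), D.NC (D.P (msig σ) w - Finsupp.single (br σ N) f) ≤ 5 * η ∧
      ‖L f‖ ≤ 8 * η := by
  obtain ⟨N, hN⟩ := D.Psig_decomp σ w
  set z := D.P (msig σ) w with hz
  have h3 := fun n => D.qF_exists (br σ n) (z (br σ n)) (ε := η * (1 / 2) ^ n) (by positivity)
  choose f hf hf' using h3
  have h4 : D.NC (z - Finsupp.single (br σ N) (∑ n ∈ Finset.range N, f n)) ≤ 5 * η := by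
    have e : z - Finsupp.single (br σ N) (∑ n ∈ Finset.range N, f n) =
        ∑ n ∈ Finset.range N, (Finsupp.single (br σ n) (z (br σ n) - f n) -
          (Finsupp.single (br σ N) (f n) - Finsupp.single (br σ n) (f n))) := by
      conv_lhs => rw [hN]
      rw [Finsupp.single_finsetSum, ← Finset.sum_sub_distrib]
      refine Finset.sum_congr rfl fun n _ => ?_
      rw [Finsupp.single_sub]; abel
    rw [e]
    refine (seminorm_sum_le _ _ _).trans ?_
    have h5 : ∀ n ∈ Finset.range N, D.NC (Finsupp.single (br σ n) (z (br σ n) - f n) -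
          (Finsupp.single (br σ N) (f n) - Finsupp.single (br σ n) (f n))) ≤
          D.qF (br σ n) (z (br σ n)) + η * (1 / 2) ^ n := by
      intro n hn
      refine (map_sub_le_add _ _ _).trans ?_
      rw [D.NC_R (D.single_br σ (Finset.mem_range.1 hn).le (hf n)), D.NC_single, add_zero]
      exact (hf' n).le
    refine (Finset.sum_le_sum h5).trans ?_
    rw [Finset.sum_add_distrib, ← Finset.mul_sum]
    have h6 := h1 N
    have h7 : η * ∑ n ∈ Finset.range N, (1 / 2 : ℝ) ^ n ≤ η * 2 :=
      mul_le_mul_of_nonneg_left (sum_geometric_two_le N) hη.le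
    linarith
  refine ⟨N, ∑ n ∈ Finset.range N, f n, Submodule.sum_mem _ fun n hn =>
    D.F_mono_br σ (Finset.mem_range.1 hn).le (hf n), h4, ?_⟩
  have h5 := (hL _).trans ((D.Sm_le _).trans h4)
  rw [map_sub, Sm_single, map_sub] at h5
  have h6 := norm_sub_le (L (Sm z)) (L (Sm z) - L (∑ n ∈ Finset.range N, f n))
  rw [sub_sub_cancel] at h6
  linarith

end TD
end NCX

open Filter Topology

namespace NCX

/-- coordinate functional of `ℓ₁` -/
noncomputable def lam (n : ℕ) : EllOne →ₗ[ℝ] ℝ where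
  toFun a := a n
  map_add' a b := by simp
  map_smul' c a := by simp

lemma lam_sum (a : EllOne) (m : ℕ) : ∑ n ∈ Finset.range m, ‖lam n a‖ ≤ ‖a‖ := by
  rw [ellOne_norm]
  exact (ellOne_summable a).sum_le_tsum _ fun _ _ => abs_nonneg _

lemma lam_le (a : EllOne) (K : ℝ) (h : ∀ m, ∑ n ∈ Finset.range m, ‖lam n a‖ ≤ K) : ‖a‖ ≤ K := by
  rw [ellOne_norm]
  exact Real.tsum_le_of_sum_range_le (fun _ => abs_nonneg _) h

namespace TD
variable {E : Type} [NormedAddCommGroup E] [NormedSpace ℝ E] (D : TD E)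
  [TopologicalSpace.SeparableSpace E]
variable {V : Type*} [NormedAddCommGroup V] [NormedSpace ℝ V]

lemma exists_TT (Φ : (List ℕ →₀ E) →ₗ[ℝ] V) (hΦ : ∀ x, ‖Φ x‖ = D.NV x) (hd : DenseRange Φ)
    (σ : ℕ → ℕ) (L : E →ₗ[ℝ] EllOne) (hL : ∀ e, ‖L e‖ ≤ ‖e‖) :
    ∃ T : ℕ → V →L[ℝ] (CantorC × ℝ),
      (∀ n, (LinearMap.range (T n : V →ₗ[ℝ] (CantorC × ℝ))).FG) ∧
      (∀ m v, ∑ n ∈ Finset.range m, ‖T n v‖ ≤ 2 * ‖v‖) ∧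
      ∀ n w, D.qF (br σ n) (D.P (msig σ) w (br σ n)) ≤ ‖T n (Φ w)‖ ∧
        ‖lam n (L (Sm (D.P (msig σ) w)))‖ ≤ ‖T n (Φ w)‖ := by
  have h1 : ∀ n, ∃ Θ : E →ₗ[ℝ] CantorC, ∀ e, ‖Θ e‖ = D.qF (br σ n) e := fun n =>
    BM (D.qF (br σ n)) (TopologicalSpace.denseSeq E) (fun x ε hε => by
      obtain ⟨i, hi⟩ := (TopologicalSpace.denseRange_denseSeq E).exists_dist_lt x hε
      exact ⟨i, (D.qF_le _ _).trans_lt (by rwa [← dist_eq_norm])⟩)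
  choose Θ hΘ using h1
  let T0 : ℕ → (List ℕ →₀ E) →ₗ[ℝ] (CantorC × ℝ) := fun n =>
    LinearMap.prod (Θ n ∘ₗ (Finsupp.lapply (R := ℝ) (br σ n) ∘ₗ D.P (msig σ)))
      (lam n ∘ₗ (L ∘ₗ (Sm ∘ₗ D.P (msig σ))))
  have hT0 : ∀ n w, ‖T0 n w‖ = max (D.qF (br σ n) (D.P (msig σ) w (br σ n)))
      ‖lam n (L (Sm (D.P (msig σ) w)))‖ := by
    intro n w
    rw [← hΘ]; rfl
  have hsum : ∀ m w, ∑ n ∈ Finset.range m, ‖T0 n w‖ ≤ 2 * ‖Φ w‖ := by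
    intro m w
    have h2 : ∑ n ∈ Finset.range m, ‖T0 n w‖ ≤
        ∑ n ∈ Finset.range m, D.qF (br σ n) (D.P (msig σ) w (br σ n)) +
        ∑ n ∈ Finset.range m, ‖lam n (L (Sm (D.P (msig σ) w)))‖ := by
      rw [← Finset.sum_add_distrib]
      refine Finset.sum_le_sum fun n _ => ?_
      rw [hT0]
      exact max_le_add_of_nonneg (apply_nonneg _ _) (norm_nonneg _)
    have h3 := D.qF_sum σ m (D.P (msig σ) w)
    have h4 := (lam_sum (L (Sm (D.P (msig σ) w))) m).trans ((hL _).trans (D.Sm_le _))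
    have h5 := D.Psig_le_NV σ w
    rw [hΦ]
    linarith
  have h2 := fun n => ext_exists Φ hd (T0 n) 2 (fun w => by
    refine le_trans ?_ (hsum (n + 1) w)
    exact Finset.single_le_sum (f := fun n => ‖T0 n w‖) (fun _ _ => norm_nonneg _)
      (Finset.self_mem_range_succ n))
  choose T hT1 hT2 hT3 using h2
  refine ⟨T, fun n => hT3 n ?_, ?_, ?_⟩
  · refine Submodule.FG.of_le ?_ (LinearMap.range_prod_le _ _)
    refine Submodule.FG.prod ?_ (IsNoetherian.noetherian _)
    rw [LinearMap.range_comp]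
    exact (D.coord_fg σ n).map _
  · intro m v
    refine hd.induction_on (p := fun v => ∑ n ∈ Finset.range m, ‖T n v‖ ≤ 2 * ‖v‖) v ?_ ?_
    · exact isClosed_le (by fun_prop) (by fun_prop)
    · intro w
      simp only [hT1]
      exact hsum m w
  · intro n w
    rw [hT1, hT0]
    exact ⟨le_max_left _ _, le_max_right _ _⟩

/-- the final step -/
theorem stepV (Φ : (List ℕ →₀ E) →ₗ[ℝ] V) (hΦ : ∀ x, ‖Φ x‖ = D.NV x) (hd : DenseRange Φ)
    (L : E →ₗ[ℝ] EllOne) (hL : ∀ e, ‖L e‖ ≤ ‖e‖)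
    {X : Type*} [NormedAddCommGroup X] [NormedSpace ℝ X] [CompleteSpace X]
    (hmin : IsMinimal X) (hX : ¬ Embeds EllOne X)
    {G : Type*} [NormedAddCommGroup G] [NormedSpace ℝ G] [CompleteSpace G] (ι : G →ₗᵢ[ℝ] E)
    (hY : ∀ σ, ∃ Y : Submodule ℝ G, IsClosed (Y : Set G) ∧ ¬ Embeds X Y ∧
      ∀ n, ∀ f ∈ D.F (br σ n), ∃ y ∈ Y, ‖f - ι y‖ ≤ ‖L f‖) : ¬ Embeds X V := by
  rintro ⟨S, c, hc, hS⟩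
  have hinf : InfD (⊤ : Submodule ℝ X) := by
    intro h
    exact hmin.1 ⟨h⟩
  obtain ⟨Ψ, hΨ, p, hp, hp1, hfr⟩ := D.exists_p Φ hΦ hd
  obtain ⟨σ, X', hX', δ, hδ, hσ⟩ := D.coreV Φ hΦ hd hX hinf S c hc hS Ψ hΨ p hp hp1 hfr
  obtain ⟨Y, hYc, hXY, hYF⟩ := hY σ
  apply hXY
  have : CompleteSpace Y := hYc.completeSpace_coe
  -- the branch projection
  obtain ⟨pσ, hpσ, hpσ1, -⟩ := ext_exists Φ hd (Ψ ∘ₗ D.P (msig σ)) 1 (fun w => by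
    rw [one_mul, hΦ, LinearMap.comp_apply, hΨ]
    exact D.Psig_le_NV σ w)
  have hge : ∀ n v, ‖p (br σ n) v‖ ≤ ‖pσ v‖ := by
    intro n v
    refine hd.induction_on (p := fun v => ‖p (br σ n) v‖ ≤ ‖pσ v‖) v ?_ ?_
    · exact isClosed_le (by fun_prop) (by fun_prop)
    · intro w
      rw [hp, hpσ, LinearMap.comp_apply, hΨ, hΨ]
      exact D.P_br_le σ n w
  have hlow : ∀ x ∈ X', δ * ‖x‖ ≤ ‖pσ (S x)‖ := by
    intro x hx
    by_cases hx0 : x = 0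
    · simp [hx0]
    have hx1 : 0 < ‖x‖ := norm_pos_iff.2 hx0
    obtain ⟨n, hn⟩ := hσ (‖x‖⁻¹ • x) (X'.smul_mem _ hx) (by
      rw [norm_smul, norm_inv, norm_norm, inv_mul_cancel₀ hx1.ne'])
    have h1 := hn.trans_le (hge n _)
    rw [map_smul, map_smul, norm_smul, norm_inv, norm_norm, inv_mul_eq_div,
      lt_div_iff₀ hx1] at h1
    exact h1.le
  obtain ⟨T, hTfg, hTs, hT⟩ := D.exists_TT Φ hΦ hd σ L hL
  set ε : ℝ := δ / 6 with hε
  have hε0 : 0 < ε := by positivity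
  let η : ℕ → ℝ := fun k => ε * (1 / 4) ^ k / 16
  have hη0 : ∀ k, 0 < η k := fun k => by positivity
  obtain ⟨x, hx, hcoef⟩ := seqQ hX'
    (fun k x => ∀ m, ∑ n ∈ Finset.range m, ‖T n (S x)‖ ≤ η k)
    (fun k l x hkl h m => (h m).trans (by
      have : (1 / 4 : ℝ) ^ l ≤ (1 / 4) ^ k := pow_le_pow_of_le_one (by norm_num) (by norm_num) hkl
      simp only [η]
      gcongr))
    (fun k S' _ hS' => A1 hX (fun n => (T n).comp S) (2 * ‖S‖) (fun m x => by
        refine (hTs m (S x)).trans ?_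
        have := S.le_opNorm x
        linarith)
      (fun n => (hTfg n).of_le (by rintro _ ⟨x, rfl⟩; exact ⟨S x, rfl⟩)) hS' (η k) (hη0 k))
  have h3 : ∀ k, ∃ w N, ∃ f ∈ D.F (br σ N), ∃ y : Y, ‖S (x k) - Φ w‖ ≤ η k ∧
      D.NC (D.P (msig σ) w - Finsupp.single (br σ N) f) ≤ 5 * η k ∧ ‖f - ι y‖ ≤ 8 * η k := by
    intro k
    obtain ⟨w, hw⟩ := D.approx Φ hΦ hd (S (x k)) (hη0 k)
    have hs : ∀ m, ∑ n ∈ Finset.range m, ‖T n (Φ w)‖ ≤ 3 * η k := by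
      intro m
      have h4 : ∑ n ∈ Finset.range m, ‖T n (Φ w)‖ ≤
          ∑ n ∈ Finset.range m, ‖T n (S (x k))‖ +
            ∑ n ∈ Finset.range m, ‖T n (S (x k) - Φ w)‖ := by
        rw [← Finset.sum_add_distrib]
        refine Finset.sum_le_sum fun n _ => ?_
        have := norm_sub_le (T n (S (x k))) (T n (S (x k) - Φ w))
        rw [← map_sub] at this
        simpa using this
      have h5 := (hx k).2.2 m
      have h6 := hTs m (S (x k) - Φ w)
      linarith
    obtain ⟨N, f, hf, h4, h5⟩ := D.approx_branch σ L hL w (η k) (hη0 k)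
      (fun m => (Finset.sum_le_sum fun n _ => (hT n w).1).trans (hs m))
      (lam_le _ _ fun m => (Finset.sum_le_sum fun n _ => (hT n w).2).trans (hs m))
    obtain ⟨y, hy, hfy⟩ := hYF N f hf
    exact ⟨w, N, f, hf, ⟨y, hy⟩, hw.le, h4, hfy.trans h5⟩
  choose w N f hf y hw hf1 hf2 using h3
  have hlc : ∀ (a : ℕ →₀ ℝ), |‖pσ (S (Finsupp.linearCombination ℝ x a))‖ -
      ‖Finsupp.linearCombination ℝ y a‖| ≤ 3 * ε * ‖Finsupp.linearCombination ℝ x a‖ := by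
    intro a
    set A := ‖Finsupp.linearCombination ℝ x a‖ with hA
    have s1 := sum_small (normSeminorm ℝ V) (fun k => S (x k) - Φ (w k)) ε A hε0.le
      (norm_nonneg _) (fun k => (hw k).trans (by
        have : 0 < ε * (1 / 4) ^ k := by positivity
        simp only [η]; linarith)) a (hcoef a)
    have s2 := sum_small D.NC (fun k => D.P (msig σ) (w k) - Finsupp.single (br σ (N k)) (f k))
      ε A hε0.le (norm_nonneg _) (fun k => (hf1 k).trans (by
        have : 0 < ε * (1 / 4) ^ k := by positivity
        simp only [η]; linarith)) a (hcoef a)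
    have s3 := sum_small (normSeminorm ℝ E) (fun k => f k - ι (y k))
      ε A hε0.le (norm_nonneg _) (fun k => (hf2 k).trans (by
        simp only [η]; linarith)) a (hcoef a)
    have e1 : Finsupp.linearCombination ℝ (fun k => S (x k) - Φ (w k)) a =
        S (Finsupp.linearCombination ℝ x a) - Φ (Finsupp.linearCombination ℝ w a) := by
      simp only [Finsupp.linearCombination_apply, Finsupp.sum, map_sum, smul_sub,
        Finset.sum_sub_distrib, map_smul]
    have e2 : Finsupp.linearCombination ℝ
        (fun k => D.P (msig σ) (w k) - Finsupp.single (br σ (N k)) (f k)) a =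
        D.P (msig σ) (Finsupp.linearCombination ℝ w a) -
          Finsupp.linearCombination ℝ (fun k => Finsupp.single (br σ (N k)) (f k)) a := by
      simp only [Finsupp.linearCombination_apply, Finsupp.sum, map_sum, smul_sub,
        Finset.sum_sub_distrib, map_smul]
    have e3 : Finsupp.linearCombination ℝ (fun k => f k - ι (y k)) a =
        Sm (Finsupp.linearCombination ℝ (fun k => Finsupp.single (br σ (N k)) (f k)) a) -
          ι (Finsupp.linearCombination ℝ y a : Y) := by
      simp only [Finsupp.linearCombination_apply, Finsupp.sum, map_sum, smul_sub,
        Finset.sum_sub_distrib, map_smul, Sm_single, Submodule.coe_sum, Submodule.coe_smul]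
    rw [e1] at s1
    rw [e2] at s2
    rw [e3] at s3
    set z := Finsupp.linearCombination ℝ w a
    set g := Finsupp.linearCombination ℝ (fun k => Finsupp.single (br σ (N k)) (f k)) a with hg
    have hgB : g ∈ D.OnB σ := by
      rw [hg, Finsupp.linearCombination_apply, Finsupp.sum]
      exact Submodule.sum_mem _ fun k _ => Submodule.smul_mem _ _ ⟨N k, f k, hf k, by simp⟩
    have t1 : |‖pσ (S (Finsupp.linearCombination ℝ x a))‖ - D.NC (D.P (msig σ) z)| ≤ ε * A := by
      rw [← hΨ, ← LinearMap.comp_apply, ← hpσ]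
      refine (abs_norm_sub_norm_le _ _).trans ?_
      rw [← map_sub]
      refine (hpσ1 _).trans ?_
      rw [one_mul]
      exact s1
    have t2 : |D.NC (D.P (msig σ) z) - D.NC g| ≤ ε * A :=
      (abs_sub_map_le_sub D.NC _ _).trans s2
    have t3 : |‖Sm g‖ - ‖Finsupp.linearCombination ℝ y a‖| ≤ ε * A := by
      refine le_trans ?_ s3
      have := abs_norm_sub_norm_le (Sm g) (ι (Finsupp.linearCombination ℝ y a : Y))
      rwa [ι.norm_map] at this
    rw [← D.OnB_NC hgB] at t3
    rw [abs_le] at t1 t2 t3 ⊢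
    constructor <;> linarith [t1.1, t1.2, t2.1, t2.2, t3.1, t3.2]
  refine minimal_seq hmin x y (linIndep_of_coef hcoef) (δ / 2) (‖S‖ + δ / 2) (by positivity) ?_ ?_
  · intro a
    have h4 := hlow (Finsupp.linearCombination ℝ x a) (by
      rw [Finsupp.linearCombination_apply, Finsupp.sum]
      exact Submodule.sum_mem _ fun k _ => Submodule.smul_mem _ _ (hx k).1)
    have h5 := (abs_le.1 (hlc a)).2
    rw [hε] at h5
    linarith
  · intro a
    have h4 := hpσ1 (S (Finsupp.linearCombination ℝ x a))
    have h5 := (abs_le.1 (hlc a)).1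
    have h6 := S.le_opNorm (Finsupp.linearCombination ℝ x a)
    rw [hε] at h5
    linarith

end TD
end NCX

open Filter Topology

namespace NCX

lemma denseRange_closure {W V : Type*} [AddCommGroup W] [Module ℝ W] [NormedAddCommGroup V]
    [NormedSpace ℝ V] (e : W →ₗ[ℝ] V) :
    DenseRange (e.codRestrict (LinearMap.range e).topologicalClosure
      fun w => (Submodule.le_topologicalClosure _) ⟨w, rfl⟩) := by
  intro z
  rw [closure_subtype]
  have hz : (z : V) ∈ closure (Set.range e) := by
    have := z.2
    rwa [← SetLike.mem_coe, Submodule.topologicalClosure_coe, LinearMap.coe_range] at this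
  convert hz using 2
  ext v
  constructor
  · rintro ⟨_, ⟨w, rfl⟩, rfl⟩; exact ⟨w, rfl⟩
  · rintro ⟨w, rfl⟩; exact ⟨_, ⟨w, rfl⟩, rfl⟩

section trunc

/-- truncation on the Cantor set -/
def tr (n : ℕ) : C(CantorSet, CantorSet) where
  toFun c := fun k => if k < n then c k else false
  continuous_toFun := by
    refine continuous_pi fun k => ?_
    by_cases h : k < n
    · simp only [h, if_true]; exact continuous_apply k
    · simp only [h, if_false]; exact continuous_const

lemma tr_apply (n : ℕ) (c : CantorSet) (k : ℕ) : tr n c k = if k < n then c k else false := rfl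

lemma tr_tr {m n : ℕ} (h : m ≤ n) (c : CantorSet) : tr n (tr m c) = tr m c := by
  funext k
  simp only [tr_apply]
  split_ifs <;> first | rfl | omega

lemma tr_tr' {m n : ℕ} (h : m ≤ n) (c : CantorSet) : tr m (tr n c) = tr m c := by
  funext k
  simp only [tr_apply]
  split_ifs <;> first | rfl | omega

/-- truncation projections on `C(2^ℕ)` -/
def trC (n : ℕ) : CantorC →ₗ[ℝ] CantorC where
  toFun g := g.comp (tr n)
  map_add' _ _ := rfl
  map_smul' _ _ := rfl

lemma trC_apply (n : ℕ) (g : CantorC) (c : CantorSet) : trC n g c = g (tr n c) := rfl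

lemma trC_norm (n : ℕ) (g : CantorC) : ‖trC n g‖ ≤ ‖g‖ :=
  (ContinuousMap.norm_le _ (norm_nonneg _)).2 fun c => g.norm_coe_le_norm (tr n c)

lemma trC_comp {m n : ℕ} (h : m ≤ n) (g : CantorC) : trC m (trC n g) = trC m g := by
  ext c; simp only [trC_apply, tr_tr h]

lemma trC_comp' {m n : ℕ} (h : m ≤ n) (g : CantorC) : trC n (trC m g) = trC m g := by
  ext c; simp only [trC_apply, tr_tr' h]

lemma trC_fg (n : ℕ) : (LinearMap.range (trC n)).FG := by
  let ψ : ((Fin n → Bool) → ℝ) →ₗ[ℝ] CantorC :=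
    { toFun := fun φ => ⟨fun c => φ fun i => c i, by
        have : Continuous fun c : CantorSet => (fun i : Fin n => c i) :=
          continuous_pi fun i => continuous_apply _
        exact (continuous_of_discreteTopology (f := φ)).comp this⟩
      map_add' := fun _ _ => rfl
      map_smul' := fun _ _ => rfl }
  have h : (LinearMap.range ψ).FG := by
    rw [LinearMap.range_eq_map]
    exact (IsNoetherian.noetherian _).map _
  refine h.of_le ?_
  rintro _ ⟨g, rfl⟩
  refine ⟨fun φ => g fun k => if hk : k < n then φ ⟨k, hk⟩ else false, ?_⟩
  ext c
  show g _ = g _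
  congr 1

lemma trC_tendsto (g : CantorC) : Tendsto (fun n => trC n g) atTop (𝓝 g) := by
  rw [ContinuousMap.tendsto_iff_tendstoUniformly]
  have h : TendstoUniformly (fun n => (tr n : CantorSet → CantorSet)) id atTop := by
    rw [tendstoUniformly_iff_tendsto, Pi.uniformity, tendsto_iInf]
    intro i
    rw [tendsto_comap_iff]
    refine Tendsto.mono_right ?_ refl_le_uniformity
    rw [tendsto_principal]
    have : ∀ᶠ q : ℕ × CantorSet in atTop ×ˢ ⊤, i < q.1 :=
      tendsto_fst.eventually (eventually_gt_atTop i)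
    filter_upwards [this] with q hq
    simp [tr_apply, hq]
  exact (CompactSpace.uniformContinuous_of_continuous g.continuous).comp_tendstoUniformly h

/-- unit vectors -/
noncomputable def ee (n : ℕ) : EllOne := lp.single 1 n 1

lemma ee_apply (n k : ℕ) : ee n k = if k = n then 1 else 0 := by
  rw [ee, lp.single_apply, Pi.single_apply]

lemma ee_norm (n : ℕ) : ‖ee n‖ = 1 := by
  rw [ee, lp.norm_single (by simp)]; simp

/-- truncation on `ℓ₁` -/
noncomputable def trL (n : ℕ) : EllOne →ₗ[ℝ] EllOne :=
  ∑ i ∈ Finset.range n, (lam i).smulRight (ee i)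

lemma trL_eq (n : ℕ) (a : EllOne) : trL n a = ∑ i ∈ Finset.range n, a i • ee i := by
  simp only [trL, LinearMap.sum_apply, LinearMap.smulRight_apply]; rfl

lemma trL_apply (n : ℕ) (a : EllOne) (k : ℕ) : trL n a k = if k < n then a k else 0 := by
  rw [trL_eq]
  have : (∑ i ∈ Finset.range n, a i • ee i : EllOne) k = ∑ i ∈ Finset.range n, (a i • ee i) k := by
    exact map_sum (lam k) _ _
  rw [this]
  simp [ee_apply]

lemma trL_norm (n : ℕ) (a : EllOne) : ‖trL n a‖ ≤ ‖a‖ := by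
  rw [ellOne_norm, ellOne_norm]
  refine (ellOne_summable _).tsum_le_tsum (fun k => ?_) (ellOne_summable a)
  rw [trL_apply]
  split_ifs
  · exact le_rfl
  · simp

lemma trL_comp {m n : ℕ} (h : m ≤ n) (a : EllOne) : trL m (trL n a) = trL m a := by
  ext k
  simp only [trL_apply]
  split_ifs <;> first | rfl | omega

lemma trL_comp' {m n : ℕ} (h : m ≤ n) (a : EllOne) : trL n (trL m a) = trL m a := by
  ext k
  simp only [trL_apply]
  split_ifs <;> first | rfl | omega

lemma trL_fg (n : ℕ) : (LinearMap.range (trL n)).FG := by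
  classical
  refine Submodule.FG.of_le (T := Submodule.span ℝ (((Finset.range n).image ee : Finset EllOne) :
    Set EllOne)) ⟨_, rfl⟩ ?_
  rintro _ ⟨a, rfl⟩
  rw [trL_eq]
  refine Submodule.sum_mem _ fun i hi => Submodule.smul_mem _ _ (Submodule.subset_span ?_)
  exact Finset.mem_coe.2 (Finset.mem_image_of_mem _ hi)

lemma trL_ee {k n : ℕ} (h : k < n) : trL n (ee k) = ee k := by
  ext j
  rw [trL_apply, ee_apply]
  split_ifs <;> first | rfl | omega

instance ellOne_separable : TopologicalSpace.SeparableSpace EllOne := by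
  rw [← TopologicalSpace.isSeparable_univ_iff]
  have h := (TopologicalSpace.IsSeparable.span (R := ℝ) (Set.countable_range ee).isSeparable).closure
  refine h.mono ?_
  intro a _
  have h1 := (lp.hasSum_single (p := 1) (by simp) a).tendsto_sum_nat
  refine mem_closure_of_tendsto h1 (Eventually.of_forall fun n => ?_)
  refine Submodule.sum_mem _ fun i _ => ?_
  have : lp.single 1 i (a i) = a i • ee i := by
    ext j
    simp [ee, lp.single_apply, Pi.single_apply]
  rw [this]
  exact Submodule.smul_mem _ _ (Submodule.subset_span ⟨i, rfl⟩)

end trunc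
end NCX

open Filter Topology

namespace NCX

section descriptive

/-- a dense sequence in `C(2^ℕ)` of finite-level functions -/
noncomputable def Dd (i : ℕ) : CantorC :=
  trC (Nat.unpair i).2 (TopologicalSpace.denseSeq CantorC (Nat.unpair i).1)

lemma Dd_fix (i : ℕ) {n : ℕ} (h : i ≤ n) : trC n (Dd i) = Dd i :=
  trC_comp' ((Nat.unpair_right_le i).trans h) _

lemma Dd_dense (y : CantorC) {r : ℝ} (hr : 0 < r) : ∃ i, dist (Dd i) y < r := by
  obtain ⟨j, hj⟩ := (TopologicalSpace.denseRange_denseSeq CantorC).exists_dist_lt y (half_pos hr)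
  have := Metric.tendsto_atTop.1 (trC_tendsto (TopologicalSpace.denseSeq CantorC j)) (r/2)
    (half_pos hr)
  obtain ⟨N, hN⟩ := this
  refine ⟨Nat.pair j N, ?_⟩
  have h2 := hN N le_rfl
  simp only [Dd, Nat.unpair_pair]
  have h3 := dist_triangle (trC N (TopologicalSpace.denseSeq CantorC j))
    (TopologicalSpace.denseSeq CantorC j) y
  rw [dist_comm y] at hj
  linarith

/-- `Y` meets the ball around `Dd i` of radius `1/(k+1)` -/
def UU (Y : SB) (i k : ℕ) : Prop :=
  ((Y.1 : Set CantorC) ∩ Metric.ball (Dd i) (1 / ((k : ℝ) + 1))).Nonempty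

lemma UU_meas (f : (ℕ → ℕ) → SB) (hf : Measurable f) (i k : ℕ) :
    MeasurableSet {σ | UU (f σ) i k} := by
  have : MeasurableSet {Y : SB | UU Y i k} :=
    MeasurableSpace.measurableSet_generateFrom ⟨_, Metric.isOpen_ball, rfl⟩
  exact hf this

/-- `d` is a good enumeration for `Y` -/
def Good (Y : SB) (d : ℕ → ℕ) : Prop :=
  (∀ n, UU Y (d n) n) ∧ ∀ i k, UU Y i k → ∀ N, ∃ n, N ≤ n ∧ dist (Dd i) (Dd (d n)) < 1 / ((k:ℝ) + 1)

lemma Good_meas (f : (ℕ → ℕ) → SB) (hf : Measurable f) :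
    MeasurableSet {q : (ℕ → ℕ) × (ℕ → ℕ) | Good (f q.1) q.2} := by
  have hd : ∀ n, Measurable fun q : (ℕ → ℕ) × (ℕ → ℕ) => q.2 n := fun n =>
    (measurable_pi_apply n).comp measurable_snd
  have h1 : ∀ n, MeasurableSet {q : (ℕ → ℕ) × (ℕ → ℕ) | UU (f q.1) (q.2 n) n} := by
    intro n
    have : {q : (ℕ → ℕ) × (ℕ → ℕ) | UU (f q.1) (q.2 n) n} =
        ⋃ j, {q : (ℕ → ℕ) × (ℕ → ℕ) | q.2 n = j} ∩ Prod.fst ⁻¹' {σ | UU (f σ) j n} := by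
      ext q
      simp
    rw [this]
    refine MeasurableSet.iUnion fun j => MeasurableSet.inter ?_ (measurable_fst (UU_meas f hf j n))
    exact (hd n) (measurableSet_singleton j)
  have h2 : ∀ i k n, MeasurableSet {q : (ℕ → ℕ) × (ℕ → ℕ) |
      dist (Dd i) (Dd (q.2 n)) < 1 / ((k:ℝ) + 1)} := fun i k n =>
    (hd n) (t := {j | dist (Dd i) (Dd j) < 1 / ((k:ℝ) + 1)}) MeasurableSpace.measurableSet_top
  have h3 : ∀ i k, MeasurableSet {q : (ℕ → ℕ) × (ℕ → ℕ) | UU (f q.1) i k} := fun i k =>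
    measurable_fst (UU_meas f hf i k)
  unfold Good
  refine measurableSet_setOfPred.2 (Measurable.and (Measurable.forall fun n =>
    measurableSet_setOfPred.1 (h1 n)) ?_)
  refine Measurable.forall fun i => Measurable.forall fun k =>
    Measurable.imp (measurableSet_setOfPred.1 (h3 i k)) ?_
  refine Measurable.forall fun N => Measurable.exists fun n =>
    Measurable.and measurable_const (measurableSet_setOfPred.1 (h2 i k n))

lemma Good_exists (Y : SB) : ∃ d, Good Y d := by
  have h : ∀ n : ℕ, ∃ j, UU Y j n ∧
      (UU Y (Nat.unpair (Nat.unpair n).1).1 (Nat.unpair (Nat.unpair n).1).2 →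
        dist (Dd (Nat.unpair (Nat.unpair n).1).1) (Dd j) <
          1 / (((Nat.unpair (Nat.unpair n).1).2 : ℝ) + 1)) := by
    intro n
    generalize (Nat.unpair (Nat.unpair n).1).1 = i
    generalize (Nat.unpair (Nat.unpair n).1).2 = k
    have hn : (0:ℝ) < 1 / ((n:ℝ) + 1) := by positivity
    by_cases hU : UU Y i k
    · obtain ⟨y, hy, hyb⟩ := hU
      rw [Metric.mem_ball] at hyb
      obtain ⟨j, hj⟩ := Dd_dense y (lt_min hn (sub_pos.2 hyb))
      obtain ⟨hj1, hj2⟩ := lt_min_iff.1 hj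
      refine ⟨j, ⟨y, hy, ?_⟩, fun _ => ?_⟩
      · rw [Metric.mem_ball, dist_comm]; exact hj1
      · have := dist_triangle (Dd i) y (Dd j)
        rw [dist_comm (Dd i) y, dist_comm y (Dd j)] at this
        linarith
    · obtain ⟨j, hj⟩ := Dd_dense 0 hn
      refine ⟨j, ⟨0, Y.1.zero_mem, ?_⟩, fun h => absurd h hU⟩
      rw [Metric.mem_ball, dist_comm]; exact hj
  choose d hd1 hd2 using h
  refine ⟨d, hd1, fun i k hU N => ⟨Nat.pair (Nat.pair i k) N, Nat.right_le_pair _ _, ?_⟩⟩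
  have := hd2 (Nat.pair (Nat.pair i k) N)
  simp only [Nat.unpair_pair] at this
  exact this hU

lemma exists_coding (f : (ℕ → ℕ) → SB) (hf : Measurable f) :
    ∃ (g : (ℕ → ℕ) → (ℕ → ℕ)) (d : (ℕ → ℕ) → (ℕ → ℕ)), Continuous d ∧
      (∀ τ, Good (f (g τ)) (d τ)) ∧ ∀ σ, ∃ τ, g τ = σ := by
  have h := (Good_meas f hf).analyticSet
  rw [MeasureTheory.AnalyticSet] at h
  rcases h with h | ⟨u, hu, hr⟩
  · obtain ⟨d, hd⟩ := Good_exists (f 0)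
    have : ((0, d) : (ℕ → ℕ) × (ℕ → ℕ)) ∈ {q : (ℕ → ℕ) × (ℕ → ℕ) | Good (f q.1) q.2} := hd
    rw [h] at this
    exact this.elim
  · refine ⟨fun τ => (u τ).1, fun τ => (u τ).2, continuous_snd.comp hu, fun τ => ?_, fun σ => ?_⟩
    · have : u τ ∈ Set.range u := ⟨τ, rfl⟩
      rw [hr] at this
      exact this
    · obtain ⟨d, hd⟩ := Good_exists (f σ)
      have : ((σ, d) : (ℕ → ℕ) × (ℕ → ℕ)) ∈ {q : (ℕ → ℕ) × (ℕ → ℕ) | Good (f q.1) q.2} := hd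
      rw [← hr] at this
      obtain ⟨τ, hτ⟩ := this
      exact ⟨τ, by simp [hτ]⟩

lemma br_eq_iff {σ τ : ℕ → ℕ} {n : ℕ} : br σ n = br τ n ↔ ∀ i < n, σ i = τ i := by
  induction n with
  | zero => simp
  | succ n ih =>
    rw [br_succ, br_succ, List.cons.injEq, ih]
    constructor
    · rintro ⟨h1, h2⟩ i hi
      rcases Nat.lt_succ_iff_lt_or_eq.1 hi with h | h
      · exact h2 i h
      · rw [h]; exact h1
    · intro h
      exact ⟨h n (Nat.lt_succ_self n), fun i hi => h i (hi.trans (Nat.lt_succ_self n))⟩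

lemma loc_const (d : (ℕ → ℕ) → (ℕ → ℕ)) (hd : Continuous d) (τ : ℕ → ℕ) (k : ℕ) :
    ∃ n, ∀ τ', br τ' n = br τ n → d τ' k = d τ k := by
  have h : IsOpen {τ' | d τ' k = d τ k} :=
    (isOpen_discrete {d τ k}).preimage ((continuous_apply k).comp hd)
  obtain ⟨I, u, hu, hs⟩ := isOpen_pi_iff.1 h τ rfl
  obtain ⟨n, hn⟩ := I.exists_nat_subset_range
  refine ⟨n, fun τ' h' => hs (a := τ') ?_⟩
  intro i hi
  have := br_eq_iff.1 h' i (Finset.mem_range.1 (hn hi))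
  rw [this]
  exact (hu i hi).2

end descriptive

section treeData

/-- the ambient space -/
abbrev EE := CantorC × EllOne

/-- truncations -/
noncomputable def rr (n : ℕ) : EE →ₗ[ℝ] EE := (trC n).prodMap (trL n)

lemma rr_apply (n : ℕ) (x : EE) : rr n x = (trC n x.1, trL n x.2) := rfl

lemma rr_comp' {m n : ℕ} (h : m ≤ n) (x : EE) : rr n (rr m x) = rr m x := by
  simp only [rr_apply, trC_comp' h, trL_comp' h]

/-- coded vectors -/
noncomputable def zz (d : ℕ → ℕ) (n : ℕ) : EE := (Dd (d n), (1 / ((n:ℝ) + 1)) • ee n)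

/-- the node subspaces -/
noncomputable def FF (d : (ℕ → ℕ) → (ℕ → ℕ)) (t : List ℕ) : Submodule ℝ EE :=
  LinearMap.eqLocus (rr t.length) LinearMap.id ⊓
    ⨅ τ : ℕ → ℕ, ⨅ (_ : br τ t.length = t), Submodule.span ℝ (Set.range (zz (d τ)))

lemma mem_FF {d : (ℕ → ℕ) → (ℕ → ℕ)} {t : List ℕ} {x : EE} :
    x ∈ FF d t ↔ rr t.length x = x ∧
      ∀ τ, br τ t.length = t → x ∈ Submodule.span ℝ (Set.range (zz (d τ))) := by
  simp [FF, Submodule.mem_iInf, LinearMap.mem_eqLocus]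

/-- the tree data -/
noncomputable def DD (d : (ℕ → ℕ) → (ℕ → ℕ)) : TD EE where
  ρ := rr
  F := FF d
  ρ_norm n x := by
    rw [rr_apply, Prod.norm_def, Prod.norm_def]
    exact max_le_max (trC_norm _ _) (trL_norm _ _)
  ρ_comp m n x h := by
    simp only [rr_apply, trC_comp h, trL_comp h]
  ρ_fg n := by
    refine ((trC_fg n).prod (trL_fg n)).of_le ?_
    rintro _ ⟨x, rfl⟩
    exact ⟨⟨_, rfl⟩, ⟨_, rfl⟩⟩
  F_fix t f hf := (mem_FF.1 hf).1
  F_mono a l := by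
    intro x hx
    rw [mem_FF] at hx ⊢
    refine ⟨?_, fun τ hτ => hx.2 τ ?_⟩
    · rw [← hx.1]
      exact rr_comp' (by simp) x
    · rw [List.length_cons, br_succ] at hτ
      exact (List.cons.inj hτ).2

lemma zz_mem (d : (ℕ → ℕ) → (ℕ → ℕ)) (hd : Continuous d) (τ : ℕ → ℕ) (k : ℕ) :
    ∃ n, zz (d τ) k ∈ FF d (br τ n) := by
  obtain ⟨n, hn⟩ := loc_const d hd τ k
  refine ⟨max n (max (d τ k) (k+1)), mem_FF.2 ⟨?_, fun τ' h' => ?_⟩⟩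
  · rw [br_length, rr_apply]
    refine Prod.ext ?_ ?_
    · exact Dd_fix _ ((le_max_left _ _).trans (le_max_right _ _))
    · show trL _ ((1 / ((k:ℝ) + 1)) • ee k) = (1 / ((k:ℝ) + 1)) • ee k
      rw [map_smul, trL_ee]
      exact (Nat.lt_succ_self k).trans_le ((le_max_right _ _).trans (le_max_right _ _))
  · rw [br_length] at h'
    have : d τ' k = d τ k := hn τ' (br_eq_iff.2 fun i hi =>
      br_eq_iff.1 h' i (hi.trans_le (le_max_left _ _)))
    refine Submodule.subset_span ⟨k, ?_⟩
    simp only [zz, this]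

/-- the isometric inclusion -/
noncomputable def inlI : CantorC →ₗᵢ[ℝ] EE where
  toLinearMap := LinearMap.inl ℝ CantorC EllOne
  norm_map' x := by simp [Prod.norm_def]

lemma inlI_apply (y : CantorC) : inlI y = (y, 0) := rfl

lemma Y_closure (d : (ℕ → ℕ) → (ℕ → ℕ)) (hd : Continuous d) (τ : ℕ → ℕ) (Y : SB)
    (hG : Good Y (d τ)) (y : CantorC) (hy : y ∈ Y.1) :
    inlI y ∈ closure (⋃ n, (FF d (br τ n) : Set EE)) := by
  rw [Metric.mem_closure_iff]
  intro ε hε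
  obtain ⟨k, hk⟩ := exists_nat_one_div_lt (half_pos hε)
  have hk0 : (0:ℝ) < 1 / ((k:ℝ) + 1) := by positivity
  obtain ⟨i, hi⟩ := Dd_dense y hk0
  have hU : UU Y i k := ⟨y, hy, by rw [Metric.mem_ball, dist_comm]; exact hi⟩
  obtain ⟨n, hnk, hn⟩ := hG.2 i k hU k
  obtain ⟨m, hm⟩ := zz_mem d hd τ n
  refine ⟨zz (d τ) n, Set.mem_iUnion.2 ⟨m, hm⟩, ?_⟩
  rw [inlI_apply, Prod.dist_eq, max_lt_iff]
  constructor
  · show dist y (Dd (d τ n)) < ε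
    have := dist_triangle y (Dd i) (Dd (d τ n))
    rw [dist_comm y (Dd i)] at this
    linarith
  · show dist 0 ((1 / ((n:ℝ) + 1)) • ee n) < ε
    rw [dist_zero_left, norm_smul, ee_norm, mul_one, Real.norm_of_nonneg (by positivity)]
    have : 1 / ((n:ℝ) + 1) ≤ 1 / ((k:ℝ) + 1) := by
      apply one_div_le_one_div_of_le (by positivity)
      have : (k:ℝ) ≤ n := by exact_mod_cast hnk
      linarith
    linarith

lemma F_approx (d : ℕ → ℕ) (Y : SB) (hG : Good Y d) (x : EE)
    (hx : x ∈ Submodule.span ℝ (Set.range (zz d))) :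
    ∃ y ∈ Y.1, ‖x - inlI y‖ ≤ ‖x.2‖ := by
  obtain ⟨a, rfl⟩ := (Finsupp.mem_span_range_iff_exists_finsupp).1 hx
  have h1 : ∀ n, ∃ y ∈ Y.1, ‖Dd (d n) - y‖ ≤ 1 / ((n:ℝ) + 1) := by
    intro n
    obtain ⟨y, hy, hb⟩ := hG.1 n
    refine ⟨y, hy, ?_⟩
    rw [← dist_eq_norm, dist_comm]
    exact (Metric.mem_ball.1 hb).le
  choose y hy hyn using h1
  refine ⟨a.sum fun n c => c • y n, Submodule.sum_mem _ fun n _ => Submodule.smul_mem _ _ (hy n), ?_⟩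
  set x := a.sum fun n c => c • zz d n with hxdef
  have hx1 : x.1 = ∑ n ∈ a.support, a n • Dd (d n) := by
    rw [hxdef, Finsupp.sum, Prod.fst_sum]; rfl
  have hx2 : x.2 = ∑ n ∈ a.support, a n • (1 / ((n:ℝ) + 1)) • ee n := by
    rw [hxdef, Finsupp.sum, Prod.snd_sum]; rfl
  have hl : ∀ k, lam k x.2 = a k * (1 / ((k:ℝ) + 1)) := by
    intro k
    rw [hx2, map_sum]
    simp only [map_smul, smul_eq_mul]
    have : ∀ n, lam k (ee n) = if k = n then 1 else 0 := fun n => ee_apply n k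
    simp only [this]
    simp only [mul_ite, mul_one, mul_zero, Finset.sum_ite_eq]
    split_ifs with h
    · rfl
    · rw [Finsupp.notMem_support_iff.1 h, zero_mul]
  rw [inlI_apply, Prod.norm_def]
  refine max_le ?_ (by simp)
  show ‖x.1 - a.sum fun n c => c • y n‖ ≤ _
  rw [hx1, Finsupp.sum, ← Finset.sum_sub_distrib]
  obtain ⟨m, hm⟩ := a.support.exists_nat_subset_range
  calc _ ≤ ∑ n ∈ a.support, ‖a n • Dd (d n) - a n • y n‖ := norm_sum_le _ _
    _ ≤ ∑ n ∈ a.support, ‖lam n x.2‖ := by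
        refine Finset.sum_le_sum fun n _ => ?_
        rw [← smul_sub, norm_smul, hl, norm_mul, Real.norm_of_nonneg (r := 1 / ((n:ℝ)+1)) (by positivity)]
        exact mul_le_mul_of_nonneg_left (hyn n) (norm_nonneg _)
    _ ≤ ∑ n ∈ Finset.range m, ‖lam n x.2‖ :=
        Finset.sum_le_sum_of_subset_of_nonneg hm fun _ _ _ => norm_nonneg _
    _ ≤ _ := lam_sum _ _

end treeData

theorem main (X : Type*) [NormedAddCommGroup X] [NormedSpace ℝ X] [CompleteSpace X]
    (hmin : IsMinimal X) (hXl1 : ¬ Embeds EllOne X) (A : Set SB) (hA : IsAnalyticIn A)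
    (hAsub : A ⊆ NCin X) : ∃ V : SB, V ∈ NCin X ∧ ∀ Y ∈ A, Embeds ↥Y.1 ↥V.1 := by
  obtain ⟨f, hf, rfl⟩ := hA
  obtain ⟨g, d, hd, hG, hg⟩ := exists_coding f hf
  obtain ⟨s, hs⟩ := TD.dense_of_le (E := EE) (DD d).NV (DD d).NV_le
  obtain ⟨Φ, hΦ⟩ := BM (DD d).NV s hs
  let W := (LinearMap.range Φ).topologicalClosure
  let Φ' : (List ℕ →₀ EE) →ₗ[ℝ] W := Φ.codRestrict W
      fun w => (Submodule.le_topologicalClosure _) ⟨w, rfl⟩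
  have hΦ' : ∀ x, ‖Φ' x‖ = (DD d).NV x := hΦ
  have hdense : DenseRange Φ' := denseRange_closure Φ
  have hWc : IsClosed (W : Set CantorC) := Submodule.isClosed_topologicalClosure _
  have : CompleteSpace W := hWc.completeSpace_coe
  refine ⟨⟨W, hWc⟩, ?_, ?_⟩
  · refine (DD d).stepV Φ' hΦ' hdense (LinearMap.snd ℝ CantorC EllOne) (fun e => norm_snd_le e)
      hmin hXl1 inlI fun τ => ⟨(f (g τ)).1, (f (g τ)).2, hAsub ⟨_, rfl⟩, fun n x hx => ?_⟩
    exact F_approx (d τ) _ (hG τ) x ((mem_FF.1 hx).2 τ (by rw [br_length]))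
  · rintro _ ⟨σ, rfl⟩
    obtain ⟨τ, rfl⟩ := hg σ
    exact (DD d).embY Φ' hΦ' τ (inlI.comp (f (g τ)).1.subtypeₗᵢ) fun y =>
      Y_closure d hd τ _ (hG τ) y y.2

end NCX

/-- **Theorem.** For every minimal Banach space `X` not containing `ℓ₁`, the class
`NC_X` of separable spaces containing no isomorphic copy of `X` is strongly bounded. -/
theorem NCX_strongly_bounded (X : Type*) [NormedAddCommGroup X] [NormedSpace ℝ X]
    [CompleteSpace X] (hmin : IsMinimal X) (hXl1 : ¬ Embeds EllOne X)
    (A : Set SB) (hA : IsAnalyticIn A) (hAsub : A ⊆ NCin X) :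
    ∃ V : SB, V ∈ NCin X ∧ ∀ Y ∈ A, Embeds ↥Y.1 ↥V.1 := by
  exact NCX.main X hmin hXl1 A hA hAsub
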